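/- arXiv:1703.06131 — 4 statements merged into one kernel-verified Lean document; each statement's English description precedes it below -/
import Mathlib

section
/- Fix n ≥ 1 and a horizon k ≥ 0. Let p₀ : ℝⁿ → [0,∞), q_i : ℝⁿ × ℝⁿ → [0,∞) (0 ≤ i ≤ k) and g_i : ℝⁿ → [0,∞) (0 ≤ i ≤ k+1) be measurable; define the pairwise potentials f₀(z,z') = p₀(z) q₀(z,z') g₀(z) g₁(z') and f_i(z,z') = q_i(z,z') g_{i+1}(z') for 1 ≤ i ≤ k, and the unnormalized smoothing density ρ(z₀,…,z_{k+1}) = ∏_{i=0}^{k} f_i(z_i, z_{i+1}) on (ℝⁿ)^{k+2}; assume ρ is strictly positive with 0 < ∫ ρ < ∞ and let Π be the probability measure with Lebesgue density ρ / ∫ρ. Let η₀,…,η_{k+1} be Borel probability measures on ℝⁿ, each absolutely continuous with strictly positive density e_i. Suppose M₀,…,M_k : ℝⁿ × ℝⁿ → ℝⁿ × ℝⁿ are measurable maps of block upper triangular form M_i(x,y) = (M_i⁰(x,y), M_i¹(y)) satisfying: c₀ := ∫ f₀ and Measure.map M₀ (η₀.prod η₁) equals the measure with Lebesgue density f₀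 / c₀; and for 1 ≤ i ≤ k, c_i := ∫∫ e_i(x) f_i(M_{i-1}¹(x), y) dx dy ∈ (0,∞) and Measure.map M_i (η_i.prod η_{i+1}) equals the measure with Lebesgue density (x,y) ↦ e_i(x) f_i(M_{i-1}¹(x), y) / c_i. Then Measure.map M_k¹ η_{k+1} equals the marginal of Π on the last coordinate z_{k+1}, i.e., the filtering distribution π_{Z_{k+1} | y_{0:k+1}}. -/
open MeasureTheory ProbabilityTheory

/-- The pairwise potentials of the smoothing density of a state-space model:
`f₀(z,z') = p₀(z) q₀(z,z') g₀(z) g₁(z')` and `f_i(z,z') = q_i(z,z') g_{i+1}(z')` for `i ≥ 1`. -/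
noncomputable def potential {n : ℕ} (p₀ : (Fin n → ℝ) → ℝ)
    (q : ℕ → (Fin n → ℝ) → (Fin n → ℝ) → ℝ) (g : ℕ → (Fin n → ℝ) → ℝ) :
    ℕ → (Fin n → ℝ) → (Fin n → ℝ) → ℝ
  | 0 => fun z z' => p₀ z * q 0 z z' * g 0 z * g 1 z'
  | (i + 1) => fun z z' => q (i + 1) z z' * g (i + 2) z'

/-- The unnormalized smoothing density `ρ(z₀,…,z_{k+1}) = ∏_{i=0}^{k} f_i(z_i, z_{i+1})`. -/
noncomputable def smoothingDensity {n k : ℕ} (p₀ : (Fin n → ℝ) → ℝ)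
    (q : ℕ → (Fin n → ℝ) → (Fin n → ℝ) → ℝ) (g : ℕ → (Fin n → ℝ) → ℝ)
    (z : Fin (k + 2) → Fin n → ℝ) : ℝ :=
  ∏ i : Fin (k + 1), potential p₀ q g i (z i.castSucc) (z i.succ)

lemma potential_nn {n k : ℕ} (p₀ : (Fin n → ℝ) → ℝ)
    (q : ℕ → (Fin n → ℝ) → (Fin n → ℝ) → ℝ) (g : ℕ → (Fin n → ℝ) → ℝ)
    (hp₀pos : ∀ z, 0 ≤ p₀ z)
    (hqpos : ∀ i ≤ k, ∀ z z', 0 ≤ q i z z')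
    (hgpos : ∀ i ≤ k + 1, ∀ z, 0 ≤ g i z) (i : ℕ) (hi : i ≤ k) (z z' : Fin n → ℝ) :
    0 ≤ potential p₀ q g i z z' := by
  cases i with
  | zero =>
    exact mul_nonneg (mul_nonneg (mul_nonneg (hp₀pos _) (hqpos 0 hi _ _))
      (hgpos 0 (by omega) _)) (hgpos 1 (by omega) _)
  | succ i => exact mul_nonneg (hqpos _ hi _ _) (hgpos _ (by omega) _)

lemma potential_meas {n k : ℕ} (p₀ : (Fin n → ℝ) → ℝ)
    (q : ℕ → (Fin n → ℝ) → (Fin n → ℝ) → ℝ) (g : ℕ → (Fin n → ℝ) → ℝ)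
    (hp₀ : Measurable p₀)
    (hq : ∀ i ≤ k, Measurable (Function.uncurry (q i)))
    (hg : ∀ i ≤ k + 1, Measurable (g i)) (i : ℕ) (hi : i ≤ k) :
    Measurable (fun p : (Fin n → ℝ) × (Fin n → ℝ) => potential p₀ q g i p.1 p.2) := by
  cases i with
  | zero =>
    have h1 := hq 0 hi
    have h2 := hg 0 (by omega)
    have h3 := hg 1 (by omega)
    exact (((hp₀.comp measurable_fst).mul h1).mul (h2.comp measurable_fst)).mul
      (h3.comp measurable_snd)
  | succ i =>
    have h1 := hq _ hi
    have h3 := hg (i + 2) (by omega)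
    exact h1.mul (h3.comp measurable_snd)

lemma lintegral_last {n j : ℕ} (G : (Fin (j + 1) → Fin n → ℝ) → (Fin n → ℝ) → ENNReal)
    (hG : Measurable (Function.uncurry G)) :
    ∫⁻ z : Fin (j + 2) → Fin n → ℝ, G (fun i => z i.castSucc) (z (Fin.last (j + 1))) =
      ∫⁻ w : Fin (j + 1) → Fin n → ℝ, ∫⁻ y : Fin n → ℝ, G w y := by
  have h := volume_preserving_piFinSuccAbove (fun _ : Fin (j + 2) => Fin n → ℝ)
    (Fin.last (j + 1))
  have h2 := h.lintegral_comp_emb (MeasurableEquiv.measurableEmbedding _)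
    (fun p : (Fin n → ℝ) × (Fin (j + 1) → Fin n → ℝ) => G p.2 p.1)
  have e : ∀ z : Fin (j + 2) → Fin n → ℝ,
      MeasurableEquiv.piFinSuccAbove (fun _ : Fin (j + 2) => Fin n → ℝ) (Fin.last (j + 1)) z
        = (z (Fin.last (j + 1)), fun i => z i.castSucc) := by
    intro z
    refine Prod.ext ?_ ?_
    · simp [MeasurableEquiv.piFinSuccAbove, Fin.insertNthEquiv]
    · ext i : 1
      simp [MeasurableEquiv.piFinSuccAbove, Fin.insertNthEquiv, Fin.init]
  simp only [e] at h2
  rw [h2, Measure.volume_eq_prod]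
  exact lintegral_prod_symm _ (hG.comp measurable_swap).aemeasurable

lemma snd_marginal {E : Type*} [MeasurableSpace E] (μ ν : Measure E)
    [IsProbabilityMeasure μ] [IsProbabilityMeasure ν] (lam : Measure E) [SFinite lam]
    (A : E × E → E) (B : E → E)
    (hA : Measurable A) (hB : Measurable B) (D : E × E → ENNReal) (hD : Measurable D)
    (hm : Measure.map (fun p : E × E => (A p, B p.2)) (μ.prod ν) = (lam.prod lam).withDensity D)
    (h : E → ENNReal) (hh : Measurable h) :
    ∫⁻ x, h (B x) ∂ν = ∫⁻ x, ∫⁻ y, D (x, y) * h y ∂lam ∂lam := by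
  have hAB : Measurable (fun p : E × E => (A p, B p.2)) :=
    hA.prodMk (hB.comp measurable_snd)
  have hh2 : Measurable (fun p : E × E => h p.2) := hh.comp measurable_snd
  have h1 : ∫⁻ p, h p.2 ∂(Measure.map (fun p : E × E => (A p, B p.2)) (μ.prod ν))
      = ∫⁻ x, h (B x) ∂ν := by
    have hh3 : Measurable (fun p : E × E => h (B p.2)) := (hh.comp hB).comp measurable_snd
    rw [lintegral_map hh2 hAB, lintegral_prod _ hh3.aemeasurable]
    simp
  rw [← h1, hm, lintegral_withDensity_eq_lintegral_mul _ hD hh2,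
    lintegral_prod _ (hD.mul hh2).aemeasurable]
  rfl

lemma smoothing_succ {n j : ℕ} (p₀ : (Fin n → ℝ) → ℝ)
    (q : ℕ → (Fin n → ℝ) → (Fin n → ℝ) → ℝ) (g : ℕ → (Fin n → ℝ) → ℝ)
    (z : Fin (j + 3) → Fin n → ℝ) :
    smoothingDensity (k := j + 1) p₀ q g z =
      smoothingDensity (k := j) p₀ q g (fun i => z i.castSucc) *
        potential p₀ q g (j + 1) (z (Fin.last (j + 1)).castSucc) (z (Fin.last (j + 2))) := by
  unfold smoothingDensity
  rw [Fin.prod_univ_castSucc]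
  rfl

/-- **Filtering via decomposable transports (Theorem on state-space models, filtering part).**
If the block upper triangular maps `M_i = (M_i⁰, M_i¹)` satisfy the transport recursion of the
decomposition theorem for state-space models, then `M_k¹` pushes the reference `η_{k+1}` forward
to the filtering distribution, i.e. the last-coordinate marginal of the smoothing posterior `Π`. -/
theorem filtering_marginal_of_recursion
    (n k : ℕ) (hn : 0 < n)
    (p₀ : (Fin n → ℝ) → ℝ)
    (q : ℕ → (Fin n → ℝ) → (Fin n → ℝ) → ℝ)
    (g : ℕ → (Fin n → ℝ) → ℝ)
    (hp₀ : Measurable p₀) (hp₀pos : ∀ z, 0 ≤ p₀ z)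
    (hq : ∀ i ≤ k, Measurable (Function.uncurry (q i)))
    (hqpos : ∀ i ≤ k, ∀ z z', 0 ≤ q i z z')
    (hg : ∀ i ≤ k + 1, Measurable (g i))
    (hgpos : ∀ i ≤ k + 1, ∀ z, 0 ≤ g i z)
    (hρpos : ∀ z, 0 < smoothingDensity (k := k) p₀ q g z)
    (hρint : Integrable (smoothingDensity (k := k) p₀ q g))
    (hρmass : 0 < ∫ z, smoothingDensity (k := k) p₀ q g z)
    (η : ℕ → Measure (Fin n → ℝ)) (e : ℕ → (Fin n → ℝ) → ℝ)
    (hηprob : ∀ i ≤ k + 1, IsProbabilityMeasure (η i))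
    (hemeas : ∀ i ≤ k + 1, Measurable (e i))
    (hηd : ∀ i ≤ k + 1,
      η i = (volume : Measure (Fin n → ℝ)).withDensity (fun x => ENNReal.ofReal (e i x)))
    (hepos : ∀ i ≤ k + 1, ∀ x, 0 < e i x)
    (M0 : ℕ → (Fin n → ℝ) × (Fin n → ℝ) → (Fin n → ℝ))
    (M1 : ℕ → (Fin n → ℝ) → (Fin n → ℝ))
    (hM0 : ∀ i ≤ k, Measurable (M0 i)) (hM1 : ∀ i ≤ k, Measurable (M1 i))
    (c : ℕ → ℝ)
    (hc0 : c 0 = ∫ p : (Fin n → ℝ) × (Fin n → ℝ), potential p₀ q g 0 p.1 p.2)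
    (hf0int : Integrable (fun p : (Fin n → ℝ) × (Fin n → ℝ) => potential p₀ q g 0 p.1 p.2))
    (hmap0 : Measure.map (fun p : (Fin n → ℝ) × (Fin n → ℝ) => (M0 0 p, M1 0 p.2))
        ((η 0).prod (η 1)) =
      (volume : Measure ((Fin n → ℝ) × (Fin n → ℝ))).withDensity
        (fun p => ENNReal.ofReal (potential p₀ q g 0 p.1 p.2 / c 0)))
    (hci : ∀ i, 1 ≤ i → i ≤ k →
      c i = ∫ p : (Fin n → ℝ) × (Fin n → ℝ),
        e i p.1 * potential p₀ q g i (M1 (i - 1) p.1) p.2)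
    (hciint : ∀ i, 1 ≤ i → i ≤ k →
      Integrable (fun p : (Fin n → ℝ) × (Fin n → ℝ) =>
        e i p.1 * potential p₀ q g i (M1 (i - 1) p.1) p.2))
    (hcipos : ∀ i, 1 ≤ i → i ≤ k → 0 < c i)
    (hmapi : ∀ i, 1 ≤ i → i ≤ k →
      Measure.map (fun p : (Fin n → ℝ) × (Fin n → ℝ) => (M0 i p, M1 i p.2))
          ((η i).prod (η (i + 1))) =
        (volume : Measure ((Fin n → ℝ) × (Fin n → ℝ))).withDensity
          (fun p => ENNReal.ofReal
            (e i p.1 * potential p₀ q g i (M1 (i - 1) p.1) p.2 / c i))) :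
    Measure.map (M1 k) (η (k + 1)) =
      Measure.map (fun z : Fin (k + 2) → Fin n → ℝ => z (Fin.last (k + 1)))
        ((volume : Measure (Fin (k + 2) → Fin n → ℝ)).withDensity
          (fun z => ENNReal.ofReal (smoothingDensity (k := k) p₀ q g z /
            ∫ z, smoothingDensity (k := k) p₀ q g z))) := by
  have hnn := potential_nn p₀ q g hp₀pos hqpos hgpos
  have hms := potential_meas p₀ q g hp₀ hq hg
  have hρm : ∀ j ≤ k, Measurable (smoothingDensity (n := n) (k := j) p₀ q g) := by
    intro j hj
    unfold smoothingDensity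
    refine Finset.measurable_prod _ fun i _ => ?_
    have hpm : Measurable (fun z : Fin (j + 2) → Fin n → ℝ => (z i.castSucc, z i.succ)) :=
      (measurable_pi_apply i.castSucc).prodMk (measurable_pi_apply i.succ)
    exact (hms i (by omega)).comp hpm
  have hρn : ∀ j ≤ k, ∀ z, 0 ≤ smoothingDensity (n := n) (k := j) p₀ q g z := by
    intro j hj z
    exact Finset.prod_nonneg fun i _ => hnn i (by omega) _ _
  have key : ∀ j ≤ k, ∃ C : ENNReal, ∀ h : (Fin n → ℝ) → ENNReal, Measurable h →
      ∫⁻ x, h (M1 j x) ∂(η (j + 1)) = C * ∫⁻ z : Fin (j + 2) → Fin n → ℝ,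
        ENNReal.ofReal (smoothingDensity (k := j) p₀ q g z) * h (z (Fin.last (j + 1))) := by
    intro j
    induction j with
    | zero =>
      intro hj
      refine ⟨ENNReal.ofReal (c 0)⁻¹, fun h hh => ?_⟩
      have := hηprob 0 (by omega)
      have := hηprob 1 (by omega)
      rw [snd_marginal (η 0) (η 1) volume (M0 0) (M1 0) (hM0 0 hj) (hM1 0 hj) _
        ((hms 0 hj).div_const _).ennreal_ofReal hmap0 h hh]
      have hG : Measurable (fun p : (Fin n → ℝ) × (Fin n → ℝ) =>
          ENNReal.ofReal (potential p₀ q g 0 p.1 p.2) * h p.2) :=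
        (hms 0 hj).ennreal_ofReal.mul (hh.comp measurable_snd)
      have hGx : ∀ x : Fin n → ℝ, Measurable (fun y : Fin n → ℝ =>
          ENNReal.ofReal (potential p₀ q g 0 x y) * h y) :=
        fun x => hG.comp measurable_prodMk_left
      have e1 : ∀ z : Fin 2 → Fin n → ℝ, smoothingDensity (k := 0) p₀ q g z =
          potential p₀ q g 0 (z 0) (z 1) := by
        intro z
        simp [smoothingDensity]
      have e2 := (volume_preserving_finTwoArrow (Fin n → ℝ)).lintegral_comp hG
      have e3 : ∫⁻ z : Fin (0 + 2) → Fin n → ℝ,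
          ENNReal.ofReal (smoothingDensity (k := 0) p₀ q g z) * h (z (Fin.last (0 + 1)))
          = ∫⁻ x : Fin n → ℝ, ∫⁻ y : Fin n → ℝ,
            ENNReal.ofReal (potential p₀ q g 0 x y) * h y := by
        rw [Measure.volume_eq_prod, lintegral_prod _ hG.aemeasurable] at e2
        rw [← e2]
        refine lintegral_congr fun z => ?_
        rw [e1]
        rfl
      rw [e3, ← lintegral_const_mul _ hG.lintegral_prod_right']
      refine lintegral_congr fun x => ?_
      rw [← lintegral_const_mul _ (hGx _)]
      refine lintegral_congr fun y => ?_
      simp only [Function.comp]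
      rw [div_eq_mul_inv, ENNReal.ofReal_mul (hnn 0 hj _ _)]
      ring
    | succ j ih =>
      intro hj
      obtain ⟨C, hC⟩ := ih (by omega)
      refine ⟨ENNReal.ofReal (c (j + 1))⁻¹ * C, fun h hh => ?_⟩
      have := hηprob (j + 1) (by omega)
      have := hηprob (j + 1 + 1) (by omega)
      have hM := hM1 j (by omega)
      have hem := hemeas (j + 1) (by omega)
      have hDm : Measurable (fun p : (Fin n → ℝ) × (Fin n → ℝ) =>
          ENNReal.ofReal (e (j + 1) p.1 * potential p₀ q g (j + 1) (M1 (j + 1 - 1) p.1) p.2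
            / c (j + 1))) := by
        refine (Measurable.div_const (Measurable.mul (hem.comp measurable_fst) ?_)
          _).ennreal_ofReal
        exact (hms (j + 1) hj).comp ((hM.comp measurable_fst).prodMk measurable_snd)
      rw [snd_marginal (η (j + 1)) (η (j + 1 + 1)) volume (M0 (j + 1)) (M1 (j + 1))
        (hM0 _ hj) (hM1 _ hj) _ hDm (hmapi (j + 1) (by omega) hj) h hh]
      have hG : Measurable (fun p : (Fin n → ℝ) × (Fin n → ℝ) =>
          ENNReal.ofReal (potential p₀ q g (j + 1) p.1 p.2) * h p.2) :=
        (hms (j + 1) hj).ennreal_ofReal.mul (hh.comp measurable_snd)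
      have hGx : ∀ x : Fin n → ℝ, Measurable (fun y : Fin n → ℝ =>
          ENNReal.ofReal (potential p₀ q g (j + 1) x y) * h y) :=
        fun x => hG.comp measurable_prodMk_left
      have hH : Measurable (fun x : Fin n → ℝ => ∫⁻ y : Fin n → ℝ,
          ENNReal.ofReal (potential p₀ q g (j + 1) x y) * h y) := hG.lintegral_prod_right'
      have hHM : Measurable (fun x : Fin n → ℝ => ∫⁻ y : Fin n → ℝ,
          ENNReal.ofReal (potential p₀ q g (j + 1) (M1 j x) y) * h y) := hH.comp hM
      have e1 := hC _ hH
      rw [hηd (j + 1) (by omega), lintegral_withDensity_eq_lintegral_mul _ hem.ennreal_ofReal hHM] at e1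
      have hGG : Measurable (Function.uncurry (fun (w : Fin (j + 2) → Fin n → ℝ)
          (y : Fin n → ℝ) => ENNReal.ofReal (smoothingDensity (k := j) p₀ q g w) *
          (ENNReal.ofReal (potential p₀ q g (j + 1) (w (Fin.last (j + 1))) y) * h y))) := by
        refine Measurable.mul
          (((hρm j (by omega)).comp measurable_fst).ennreal_ofReal) ?_
        have hpm : Measurable (fun p : (Fin (j + 2) → Fin n → ℝ) × (Fin n → ℝ) =>
            (p.1 (Fin.last (j + 1)), p.2)) :=
          ((measurable_pi_apply _).comp measurable_fst).prodMk measurable_snd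
        exact hG.comp hpm
      have e2 := lintegral_last _ hGG
      have e3 : ∫⁻ z : Fin (j + 1 + 2) → Fin n → ℝ,
          ENNReal.ofReal (smoothingDensity (k := j + 1) p₀ q g z) *
            h (z (Fin.last (j + 1 + 1))) =
          ∫⁻ w : Fin (j + 2) → Fin n → ℝ,
            ENNReal.ofReal (smoothingDensity (k := j) p₀ q g w) *
            ∫⁻ y : Fin n → ℝ,
              ENNReal.ofReal (potential p₀ q g (j + 1) (w (Fin.last (j + 1))) y) * h y := by
        trans
        · refine (lintegral_congr fun z => ?_).trans e2
          rw [smoothing_succ, ENNReal.ofReal_mul (hρn j (by omega) _), mul_assoc]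
        · refine lintegral_congr fun w => ?_
          exact lintegral_const_mul _ (hGx _)
      rw [e3, mul_assoc, ← e1,
        ← lintegral_const_mul _ (hem.ennreal_ofReal.mul hHM)]
      refine lintegral_congr fun x => ?_
      simp only [Pi.mul_apply, Function.comp]
      rw [← mul_assoc, ← lintegral_const_mul _ (hGx _)]
      refine lintegral_congr fun y => ?_
      simp only [Function.comp, Nat.add_sub_cancel]
      rw [div_eq_mul_inv, ENNReal.ofReal_mul (mul_nonneg (hepos _ (by omega) _).le
        (hnn _ hj _ _)), ENNReal.ofReal_mul (hepos _ (by omega) _).le]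
      ring
  obtain ⟨C, hC⟩ := key k le_rfl
  have := hηprob (k + 1) le_rfl
  have hM := hM1 k le_rfl
  have hρ := hρm k le_rfl
  have hI : ∫⁻ z, ENNReal.ofReal (smoothingDensity (n := n) (k := k) p₀ q g z) =
      ENNReal.ofReal (∫ z, smoothingDensity (n := n) (k := k) p₀ q g z) :=
    (ofReal_integral_eq_lintegral_ofReal hρint
      (Filter.Eventually.of_forall (hρn k le_rfl))).symm
  set I := ∫ z, smoothingDensity (n := n) (k := k) p₀ q g z with hIdef
  have hC1 : C = ENNReal.ofReal I⁻¹ := by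
    have h1 := hC (fun _ => 1) measurable_const
    simp only [mul_one, hI] at h1
    simp only [lintegral_const, measure_univ, mul_one] at h1
    rw [ENNReal.ofReal_inv_of_pos hρmass]
    exact ENNReal.eq_inv_of_mul_eq_one_left h1.symm
  ext s hs
  have h1 := hC (s.indicator 1) (measurable_one.indicator hs)
  have hl : Measurable (fun z : Fin (k + 2) → Fin n → ℝ => z (Fin.last (k + 1))) :=
    measurable_pi_apply _
  have hsl : Measurable (fun z : Fin (k + 2) → Fin n → ℝ =>
      s.indicator (1 : (Fin n → ℝ) → ENNReal) (z (Fin.last (k + 1)))) :=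
    (measurable_one.indicator hs).comp hl
  have hfin : Measurable (fun z : Fin (k + 2) → Fin n → ℝ =>
      ENNReal.ofReal (smoothingDensity (k := k) p₀ q g z) *
      s.indicator (1 : (Fin n → ℝ) → ENNReal) (z (Fin.last (k + 1)))) :=
    hρ.ennreal_ofReal.mul hsl
  rw [← lintegral_indicator_one hs, ← lintegral_indicator_one hs,
    lintegral_map (measurable_one.indicator hs) hM,
    lintegral_map (measurable_one.indicator hs) hl, h1,
    lintegral_withDensity_eq_lintegral_mul _ (hρ.div_const _).ennreal_ofReal hsl,
    ← lintegral_const_mul _ hfin]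
  refine lintegral_congr fun z => ?_
  simp only [Pi.mul_apply, Function.comp]
  rw [hC1, div_eq_mul_inv, ENNReal.ofReal_mul (hρn k le_rfl _)]
  ring
end

section
/- With the same state-space setup: fix n ≥ 1, k ≥ 0, measurable p₀ : ℝⁿ → [0,∞), q_i : ℝⁿ × ℝⁿ → [0,∞) (0 ≤ i ≤ k), g_i : ℝⁿ → [0,∞) (0 ≤ i ≤ k+1); potentials f₀(z,z') = p₀(z) q₀(z,z') g₀(z) g₁(z'), f_i(z,z') = q_i(z,z') g_{i+1}(z') for 1 ≤ i ≤ k; ρ(z₀,…,z_{k+1}) = ∏_{i=0}^{k} f_i(z_i, z_{i+1}) strictly positive with 0 < ∫ρ < ∞; Π the probability measure with density ρ/∫ρ; reference probability measures η₀,…,η_{k+1} on ℝⁿ absolutely continuous with strictly positive densities e_i; and measurable block upper triangular maps M_i(x,y) = (M_i⁰(x,y), M_i¹(y)) satisfying c₀ := ∫ f₀, Measure.map M₀ (η₀.prod η₁) = measure with density f₀/c₀, and for 1 ≤ i ≤ k, c_i := ∫∫ e_i(x) f_i(M_{i-1}¹(x), y) dx dy ∈ (0,∞) and Measure.map M_i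 (η_i.prod η_{i+1}) = measure with density (x,y) ↦ e_i(x) f_i(M_{i-1}¹(x), y)/c_i. For 0 ≤ i ≤ k define T_i : (ℝⁿ)^{k+2} → (ℝⁿ)^{k+2} by T_i(x₀,…,x_{k+1}) = (x₀,…,x_{i-1}, M_i⁰(x_i, x_{i+1}), M_i¹(x_{i+1}), x_{i+2},…,x_{k+1}). Then the composition 𝔗_k = T₀ ∘ T₁ ∘ ⋯ ∘ T_k satisfies Measure.map 𝔗_k (η₀ ⊗ η₁ ⊗ ⋯ ⊗ η_{k+1}) = Π; that is, the decomposable transport 𝔗_k pushes the product reference measure forward to the full Bayesian solution π_{Z_{0:k+1} | y_{0:k+1}}. -/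
open MeasureTheory ProbabilityTheory

/-- The embedding `T_i` of the block map `M_i` into the identity on `(ℝⁿ)^{k+2}`:
`T_i(x₀,…,x_{k+1}) = (x₀,…,x_{i-1}, M_i⁰(x_i,x_{i+1}), M_i¹(x_{i+1}), x_{i+2},…,x_{k+1})`. -/
noncomputable def stepMap {n k : ℕ} (M0 : ℕ → (Fin n → ℝ) × (Fin n → ℝ) → (Fin n → ℝ))
    (M1 : ℕ → (Fin n → ℝ) → (Fin n → ℝ)) (i : ℕ)
    (z : Fin (k + 2) → Fin n → ℝ) : Fin (k + 2) → Fin n → ℝ :=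
  fun j =>
    if (j : ℕ) = i then M0 i (z j, z (j + 1))
    else if (j : ℕ) = i + 1 then M1 i (z j)
    else z j

/-- The composition `𝔗_i = T₀ ∘ T₁ ∘ ⋯ ∘ T_i` (with `T_i` applied first). -/
noncomputable def bigTransport {n k : ℕ} (M0 : ℕ → (Fin n → ℝ) × (Fin n → ℝ) → (Fin n → ℝ))
    (M1 : ℕ → (Fin n → ℝ) → (Fin n → ℝ)) :
    ℕ → ((Fin (k + 2) → Fin n → ℝ) → (Fin (k + 2) → Fin n → ℝ))
  | 0 => stepMap M0 M1 0
  | (i + 1) => bigTransport M0 M1 i ∘ stepMap M0 M1 (i + 1)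

theorem aux_pair {E ι : Type*} [MeasurableSpace E] [Fintype ι] [DecidableEq ι]
    (μ : ι → Measure E) [∀ i, IsProbabilityMeasure (μ i)] (a b : ι) (hab : a ≠ b)
    (M : E × E → E × E) (hM : Measurable M) (w : E × E → ENNReal) (hw : Measurable w)
    (hMw : Measure.map M ((μ a).prod (μ b)) = ((μ a).prod (μ b)).withDensity w)
    (T : (ι → E) → (ι → E)) (hTa : ∀ z, T z a = (M (z a, z b)).1)
    (hTb : ∀ z, T z b = (M (z a, z b)).2)
    (hTj : ∀ z j, j ≠ a → j ≠ b → T z j = z j) :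
    Measure.map T (Measure.pi μ) = (Measure.pi μ).withDensity (fun z => w (z a, z b)) := by
  classical
  let S : Finset ι := {a, b}
  let P : (ι → E) → E × E := fun z => (z a, z b)
  let Q : (ι → E) → ((Sᶜ : Finset ι) → E) := fun z j => z j
  let R : (E × E) × ((Sᶜ : Finset ι) → E) → (ι → E) := fun p j =>
    if h : j ∈ Sᶜ then p.2 ⟨j, h⟩ else if j = a then p.1.1 else p.1.2
  have hP : Measurable P := by fun_prop
  have hQ : Measurable Q := by fun_prop
  have hR : Measurable R := by
    refine measurable_pi_lambda _ fun j => ?_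
    by_cases h : j ∈ Sᶜ
    · simp only [R, h, dif_pos]; fun_prop
    · by_cases h' : j = a
      · simp only [R, h', if_true]
        have : a ∉ Sᶜ := by simp [S]
        simp only [this, dite_false]; fun_prop
      · simp only [R, h, h', dite_false, if_false]; fun_prop
  have hPR : ∀ p, P (R p) = p.1 := by
    intro p
    simp [P, R, S, hab.symm]
  have hRT : ∀ z, R (M (P z), Q z) = T z := by
    intro z; funext j
    by_cases h : j ∈ Sᶜ
    · have h2 : j ≠ a ∧ j ≠ b := by simpa [S] using h
      simp only [R, h, dif_pos, Q]
      exact (hTj z j h2.1 h2.2).symm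
    · by_cases h' : j = a
      · subst h'; simp [R, S, P, hTa]
      · have hb : j = b := by
          simp only [S, Finset.mem_compl, not_not, Finset.mem_insert, Finset.mem_singleton] at h
          tauto
        subst hb; simp [R, S, P, h', hTb]
  have hRid : ∀ z, R (P z, Q z) = z := by
    intro z; funext j
    by_cases h : j ∈ Sᶜ
    · simp only [R, h, dif_pos, Q]
    · by_cases h' : j = a
      · subst h'; simp [R, S, P]
      · have hb : j = b := by
          simp only [S, Finset.mem_compl, not_not, Finset.mem_insert, Finset.mem_singleton] at h
          tauto
        subst hb; simp [R, S, P, h']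
  have hind : iIndepFun (fun i (z : ι → E) => z i) (Measure.pi μ) :=
    iIndepFun_pi (X := fun _ => id) (fun _ => aemeasurable_id)
  have hPlaw : Measure.map P (Measure.pi μ) = (μ a).prod (μ b) := by
    have := (hind.indepFun hab).map_prod_eq_prod_map_map
      (measurable_pi_apply a).aemeasurable (measurable_pi_apply b).aemeasurable
    have h1 : Measure.map (fun z : ι → E => z a) (Measure.pi μ) = μ a :=
      (measurePreserving_eval μ a).map_eq
    have h2 : Measure.map (fun z : ι → E => z b) (Measure.pi μ) = μ b :=
      (measurePreserving_eval μ b).map_eq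
    rw [h1, h2] at this
    exact this
  have hPQ : IndepFun P Q (Measure.pi μ) := by
    have h := hind.indepFun_finset S Sᶜ disjoint_compl_right (fun i => measurable_pi_apply i)
    have := h.comp (φ := fun r : S → E => (r ⟨a, by simp [S]⟩, r ⟨b, by simp [S]⟩)) (ψ := id)
      (by fun_prop) measurable_id
    exact this
  have hjoint := hPQ.map_prod_eq_prod_map_map hP.aemeasurable hQ.aemeasurable
  rw [hPlaw] at hjoint
  set ν := Measure.map Q (Measure.pi μ) with hν
  have : IsProbabilityMeasure ν := Measure.isProbabilityMeasure_map hQ.aemeasurable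
  have hT : T = R ∘ (Prod.map M id) ∘ (fun z => (P z, Q z)) := by
    funext z; exact (hRT z).symm
  have hid : Measure.map R (((μ a).prod (μ b)).prod ν) = Measure.pi μ := by
    rw [← hjoint, Measure.map_map hR (by fun_prop)]
    have : (R ∘ fun z => (P z, Q z)) = id := by funext z; exact hRid z
    rw [this, Measure.map_id]
  rw [hT, ← Measure.map_map hR (by fun_prop), ← Measure.map_map (by fun_prop) (by fun_prop), hjoint,
    ← Measure.map_prod_map _ _ hM measurable_id, hMw, Measure.map_id, prod_withDensity_left hw]
  conv_rhs => rw [← hid]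
  ext s hs
  rw [Measure.map_apply hR hs, withDensity_apply _ hs, withDensity_apply _ (hR hs),
    setLIntegral_map hs (by fun_prop) hR]
  refine setLIntegral_congr_fun (hR hs) fun p _ => ?_
  exact congrArg w (hPR p).symm

theorem aux_map_withDensity {α β : Type*} [MeasurableSpace α] [MeasurableSpace β] (μ : Measure α)
    (R : α → β) (hR : Measurable R) (v : β → ENNReal) (hv : Measurable v) :
    Measure.map R (μ.withDensity (fun x => v (R x))) = (Measure.map R μ).withDensity v := by
  ext s hs
  rw [Measure.map_apply hR hs, withDensity_apply _ hs, withDensity_apply _ (hR hs),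
    setLIntegral_map hs hv hR]

theorem aux_pi_density {E ι : Type*} [MeasurableSpace E] [Fintype ι]
    (μ : ι → Measure E) [∀ i, IsProbabilityMeasure (μ i)] (V : Measure E) [SigmaFinite V]
    (d : ι → E → ENNReal) (hd : ∀ i, Measurable (d i)) (h : ∀ i, V = (μ i).withDensity (d i)) :
    Measure.pi (fun _ : ι => V) = (Measure.pi μ).withDensity (fun z => ∏ i, d i (z i)) := by
  refine Measure.pi_eq fun s hs => ?_
  rw [withDensity_apply _ (MeasurableSet.univ_pi hs), ← lintegral_indicator (MeasurableSet.univ_pi hs)]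
  have hind : iIndepFun (fun i (z : ι → E) => (s i).indicator (d i) (z i)) (Measure.pi μ) :=
    iIndepFun_pi (X := fun i => (s i).indicator (d i))
      (fun i => ((hd i).indicator (hs i)).aemeasurable)
  have h1 := lintegral_prod_eq_prod_lintegral_of_indepFun Finset.univ _ hind
    (fun i => ((hd i).indicator (hs i)).comp (measurable_pi_apply i))
  calc _ = ∫⁻ z, ∏ i, (s i).indicator (d i) (z i) ∂(Measure.pi μ) := by
        refine lintegral_congr fun z => ?_
        by_cases hz : z ∈ Set.univ.pi s
        · rw [Set.indicator_of_mem hz]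
          refine Finset.prod_congr rfl fun i _ => ?_
          rw [Set.indicator_of_mem (hz i trivial)]
        · rw [Set.indicator_of_notMem hz]
          simp only [Set.mem_pi, Set.mem_univ, true_imp_iff, not_forall] at hz
          obtain ⟨i, hi⟩ := hz
          exact (Finset.prod_eq_zero (Finset.mem_univ i) (Set.indicator_of_notMem hi _)).symm
    _ = _ := h1
    _ = _ := by
        refine Finset.prod_congr rfl fun i _ => ?_
        have h2 := (measurePreserving_eval μ i).lintegral_comp ((hd i).indicator (hs i))
        simp only [Function.eval] at h2
        rw [h2, lintegral_indicator (hs i), ← withDensity_apply _ (hs i), ← h i]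

theorem aux_big {n k : ℕ} (M0 : ℕ → (Fin n → ℝ) × (Fin n → ℝ) → (Fin n → ℝ))
    (M1 : ℕ → (Fin n → ℝ) → (Fin n → ℝ)) (i : ℕ) : ∀ (z : Fin (k + 2) → Fin n → ℝ)
    (j : Fin (k + 2)), ((j : ℕ) = i + 1 → bigTransport M0 M1 i z j = M1 i (z j)) ∧
      (i + 1 < (j : ℕ) → bigTransport M0 M1 i z j = z j) := by
  induction i with
  | zero =>
    intro z j
    refine ⟨fun h => ?_, fun h => ?_⟩
    · simp [bigTransport, stepMap, h]
    · have h1 : (j : ℕ) ≠ 0 := by omega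
      have h2 : (j : ℕ) ≠ 1 := by omega
      simp only [bigTransport, stepMap, zero_add, h1, h2, if_false]
  | succ i ih =>
    intro z j
    refine ⟨fun h => ?_, fun h => ?_⟩
    · simp only [bigTransport, Function.comp]
      rw [(ih _ j).2 (by omega)]
      simp [stepMap, h]
    · simp only [bigTransport, Function.comp]
      rw [(ih _ j).2 (by omega)]
      have h1 : (j : ℕ) ≠ i + 1 := by omega
      have h2 : (j : ℕ) ≠ i + 1 + 1 := by omega
      simp only [stepMap, h1, h2, if_false]

theorem aux_step_meas {n k : ℕ} (M0 : ℕ → (Fin n → ℝ) × (Fin n → ℝ) → (Fin n → ℝ))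
    (M1 : ℕ → (Fin n → ℝ) → (Fin n → ℝ)) (i : ℕ) (h0 : Measurable (M0 i)) (h1 : Measurable (M1 i)) :
    Measurable (stepMap (k := k) M0 M1 i) := by
  refine measurable_pi_lambda _ fun j => ?_
  unfold stepMap
  split_ifs <;> fun_prop

theorem aux_big_meas {n k : ℕ} (M0 : ℕ → (Fin n → ℝ) × (Fin n → ℝ) → (Fin n → ℝ))
    (M1 : ℕ → (Fin n → ℝ) → (Fin n → ℝ)) (hM0 : ∀ i ≤ k, Measurable (M0 i))
    (hM1 : ∀ i ≤ k, Measurable (M1 i)) (i : ℕ) (hi : i ≤ k) :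
    Measurable (bigTransport (k := k) M0 M1 i) := by
  induction i with
  | zero => exact aux_step_meas _ _ _ (hM0 _ hi) (hM1 _ hi)
  | succ i ih => exact (ih (by omega)).comp (aux_step_meas _ _ _ (hM0 _ hi) (hM1 _ hi))

set_option maxHeartbeats 2000000 in
/-- **The full Bayesian solution via a decomposable transport.**
Under the transport recursion of the decomposition theorem for state-space models, the
decomposable transport `𝔗_k = T₀ ∘ ⋯ ∘ T_k` pushes the product reference measure
`η₀ ⊗ ⋯ ⊗ η_{k+1}` forward to the smoothing posterior `Π`. -/
theorem full_bayesian_solution_of_recursion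
    (n k : ℕ) (hn : 0 < n)
    (p₀ : (Fin n → ℝ) → ℝ)
    (q : ℕ → (Fin n → ℝ) → (Fin n → ℝ) → ℝ)
    (g : ℕ → (Fin n → ℝ) → ℝ)
    (hp₀ : Measurable p₀) (hp₀pos : ∀ z, 0 ≤ p₀ z)
    (hq : ∀ i ≤ k, Measurable (Function.uncurry (q i)))
    (hqpos : ∀ i ≤ k, ∀ z z', 0 ≤ q i z z')
    (hg : ∀ i ≤ k + 1, Measurable (g i))
    (hgpos : ∀ i ≤ k + 1, ∀ z, 0 ≤ g i z)
    (hρpos : ∀ z, 0 < smoothingDensity (k := k) p₀ q g z)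
    (hρint : Integrable (smoothingDensity (k := k) p₀ q g))
    (hρmass : 0 < ∫ z, smoothingDensity (k := k) p₀ q g z)
    (η : ℕ → Measure (Fin n → ℝ)) (e : ℕ → (Fin n → ℝ) → ℝ)
    (hηprob : ∀ i ≤ k + 1, IsProbabilityMeasure (η i))
    (hemeas : ∀ i ≤ k + 1, Measurable (e i))
    (hηd : ∀ i ≤ k + 1,
      η i = (volume : Measure (Fin n → ℝ)).withDensity (fun x => ENNReal.ofReal (e i x)))
    (hepos : ∀ i ≤ k + 1, ∀ x, 0 < e i x)
    (M0 : ℕ → (Fin n → ℝ) × (Fin n → ℝ) → (Fin n → ℝ))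
    (M1 : ℕ → (Fin n → ℝ) → (Fin n → ℝ))
    (hM0 : ∀ i ≤ k, Measurable (M0 i)) (hM1 : ∀ i ≤ k, Measurable (M1 i))
    (c : ℕ → ℝ)
    (hc0 : c 0 = ∫ p : (Fin n → ℝ) × (Fin n → ℝ), potential p₀ q g 0 p.1 p.2)
    (hf0int : Integrable (fun p : (Fin n → ℝ) × (Fin n → ℝ) => potential p₀ q g 0 p.1 p.2))
    (hmap0 : Measure.map (fun p : (Fin n → ℝ) × (Fin n → ℝ) => (M0 0 p, M1 0 p.2))
        ((η 0).prod (η 1)) =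
      (volume : Measure ((Fin n → ℝ) × (Fin n → ℝ))).withDensity
        (fun p => ENNReal.ofReal (potential p₀ q g 0 p.1 p.2 / c 0)))
    (hci : ∀ i, 1 ≤ i → i ≤ k →
      c i = ∫ p : (Fin n → ℝ) × (Fin n → ℝ),
        e i p.1 * potential p₀ q g i (M1 (i - 1) p.1) p.2)
    (hciint : ∀ i, 1 ≤ i → i ≤ k →
      Integrable (fun p : (Fin n → ℝ) × (Fin n → ℝ) =>
        e i p.1 * potential p₀ q g i (M1 (i - 1) p.1) p.2))
    (hcipos : ∀ i, 1 ≤ i → i ≤ k → 0 < c i)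
    (hmapi : ∀ i, 1 ≤ i → i ≤ k →
      Measure.map (fun p : (Fin n → ℝ) × (Fin n → ℝ) => (M0 i p, M1 i p.2))
          ((η i).prod (η (i + 1))) =
        (volume : Measure ((Fin n → ℝ) × (Fin n → ℝ))).withDensity
          (fun p => ENNReal.ofReal
            (e i p.1 * potential p₀ q g i (M1 (i - 1) p.1) p.2 / c i))) :
    Measure.map (bigTransport (k := k) M0 M1 k)
        (Measure.pi (fun i : Fin (k + 2) => η i)) =
      (volume : Measure (Fin (k + 2) → Fin n → ℝ)).withDensity
        (fun z => ENNReal.ofReal (smoothingDensity (k := k) p₀ q g z /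
          ∫ z, smoothingDensity (k := k) p₀ q g z)) := by
  have hpm : ∀ a b : Fin (k + 2), Measurable (fun z : Fin (k + 2) → Fin n → ℝ => (z a, z b)) :=
    fun a b => by fun_prop
  have hfpos : ∀ i ≤ k, ∀ x y, 0 < potential p₀ q g i x y := by
    intro i hi x y
    have hnn : 0 ≤ potential p₀ q g i x y := by
      cases i with
      | zero =>
        exact mul_nonneg (mul_nonneg (mul_nonneg (hp₀pos x) (hqpos 0 hi x y))
          (hgpos 0 (by omega) x)) (hgpos 1 (by omega) y)
      | succ i => exact mul_nonneg (hqpos _ hi x y) (hgpos _ (by omega) y)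
    refine lt_of_le_of_ne hnn (Ne.symm ?_)
    have h := (hρpos (fun j => if (j : ℕ) ≤ i then x else y)).ne'
    unfold smoothingDensity at h
    have h2 := Finset.prod_ne_zero_iff.1 h ⟨i, by omega⟩ (Finset.mem_univ _)
    simpa using h2
  have hfmeas : ∀ i ≤ k,
      Measurable (fun p : (Fin n → ℝ) × (Fin n → ℝ) => potential p₀ q g i p.1 p.2) := by
    intro i hi
    have h1 : Measurable (fun p : (Fin n → ℝ) × (Fin n → ℝ) => q i p.1 p.2) := hq i hi
    have h2 := hg (i + 1) (by omega)
    cases i with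
    | zero =>
      have h3 := hg 0 (by omega)
      simp only [potential]
      exact (((hp₀.comp measurable_fst).mul h1).mul (h3.comp measurable_fst)).mul
        (h2.comp measurable_snd)
    | succ i => exact h1.mul (h2.comp measurable_snd)
  have hprob : ∀ i : Fin (k + 2), IsProbabilityMeasure (η i) :=
    fun i => hηprob i (by have := i.2; omega)
  have hc0pos : 0 < c 0 := by
    by_contra hneg
    push Not at hneg
    have := hηprob 0 (by omega)
    have := hηprob 1 (by omega)
    have h := congrArg (fun m => m Set.univ) hmap0
    have hz : (fun p : (Fin n → ℝ) × (Fin n → ℝ) =>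
        ENNReal.ofReal (potential p₀ q g 0 p.1 p.2 / c 0)) = 0 := by
      funext p
      exact ENNReal.ofReal_of_nonpos
        (div_nonpos_of_nonneg_of_nonpos (hfpos 0 (by omega) _ _).le hneg)
    have hm : Measurable (fun p : (Fin n → ℝ) × (Fin n → ℝ) => (M0 0 p, M1 0 p.2)) :=
      (hM0 0 (by omega)).prodMk ((hM1 0 (by omega)).comp measurable_snd)
    rw [hz] at h
    simp [Measure.map_apply hm MeasurableSet.univ] at h
  have hcpos : ∀ i ≤ k, 0 < c i := by
    intro i hi
    rcases Nat.eq_zero_or_pos i with h | h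
    · rw [h]; exact hc0pos
    · exact hcipos i h hi
  -- product reference densities
  have hηprod : ∀ i ≤ k, ∀ F : (Fin n → ℝ) × (Fin n → ℝ) → ℝ, Measurable F →
      (volume : Measure ((Fin n → ℝ) × (Fin n → ℝ))).withDensity (fun p => ENNReal.ofReal (F p)) =
      ((η i).prod (η (i + 1))).withDensity
        (fun p => ENNReal.ofReal (F p / (e i p.1 * e (i + 1) p.2))) := by
    intro i hi F hF
    have m1 := hemeas i (by omega)
    have m2 := hemeas (i + 1) (by omega)
    have := hηprob i (by omega)
    have := hηprob (i + 1) (by omega)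
    have e1 := hηd i (by omega)
    have e2 := hηd (i + 1) (by omega)
    have : SFinite ((volume : Measure (Fin n → ℝ)).withDensity
        (fun x => ENNReal.ofReal (e i x))) := by rw [← e1]; infer_instance
    have : SFinite ((volume : Measure (Fin n → ℝ)).withDensity
        (fun x => ENNReal.ofReal (e (i + 1) x))) := by rw [← e2]; infer_instance
    rw [e1, e2, prod_withDensity (by fun_prop) (by fun_prop),
      ← withDensity_mul _ (by fun_prop) (by fun_prop), ← Measure.volume_eq_prod]
    congr 1
    funext p
    have p1 := hepos i (by omega) p.1
    have p2 := hepos (i + 1) (by omega) p.2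
    simp only [Pi.mul_apply]
    rw [← ENNReal.ofReal_mul p1.le, ← ENNReal.ofReal_mul (by positivity)]
    congr 1
    field_simp
  let π := Measure.pi (fun i : Fin (k + 2) => η i)
  let h : ℕ → (Fin n → ℝ) → (Fin n → ℝ) → ℝ := fun j x y =>
    potential p₀ q g j x y / c j / (e (j + 1) y) / (if j = 0 then e 0 x else 1)
  have hhpos : ∀ i ≤ k, ∀ x y, 0 < h i x y := by
    intro i hi x y
    have := hfpos i hi x y
    have := hcpos i hi
    have := hepos (i + 1) (by omega) y
    have := hepos 0 (by omega) x
    simp only [h]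
    split_ifs <;> positivity
  have hhmeas : ∀ i ≤ k,
      Measurable (fun p : (Fin n → ℝ) × (Fin n → ℝ) => h i p.1 p.2) := by
    intro i hi
    have h1 := hfmeas i hi
    have h2 := hemeas (i + 1) (by omega)
    have h3 := hemeas 0 (by omega)
    simp only [h]
    split_ifs <;> fun_prop
  obtain ⟨ix, hcast⟩ : ∃ ix : ℕ → Fin (k + 2), ∀ i ≤ k + 1, ((ix i : Fin (k + 2)) : ℕ) = i :=
    ⟨Fin.ofNat (k + 2), fun i hi => Nat.mod_eq_of_lt (by omega)⟩
  have hstep : ∀ i ≤ k, ∀ w : (Fin n → ℝ) × (Fin n → ℝ) → ENNReal, Measurable w →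
      Measure.map (fun p : (Fin n → ℝ) × (Fin n → ℝ) => (M0 i p, M1 i p.2))
          ((η i).prod (η (i + 1))) = ((η i).prod (η (i + 1))).withDensity w →
      Measure.map (stepMap M0 M1 i) π =
        π.withDensity (fun z => w (z (ix i), z (ix (i + 1)))) := by
    intro i hi w hw hmap
    have ha := hcast i (by omega)
    have hb := hcast (i + 1) (by omega)
    have hm : Measurable (fun p : (Fin n → ℝ) × (Fin n → ℝ) => (M0 i p, M1 i p.2)) :=
      (hM0 i hi).prodMk ((hM1 i hi).comp measurable_snd)
    refine aux_pair (fun i : Fin (k + 2) => η i) _ _ ?_ _ hm w hw ?_ _ ?_ ?_ ?_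
    · intro hh
      rw [Fin.ext_iff, ha, hb] at hh
      omega
    · rw [ha, hb]; exact hmap
    · intro z
      have h1 : ix i + 1 = ix (i + 1) := by
        rw [Fin.ext_iff, hb, Fin.val_add_one_of_lt' (by omega), ha]
      simp only [stepMap, ha, if_true, h1]
    · intro z
      have : i + 1 ≠ i := by omega
      simp only [stepMap, hb, this, if_true, if_false]
    · intro z j h1 h2
      rw [Ne, Fin.ext_iff, ha] at h1
      rw [Ne, Fin.ext_iff, hb] at h2
      simp only [stepMap, h1, h2, if_false]
  have key : ∀ i ≤ k, Measure.map (bigTransport (k := k) M0 M1 i) π =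
      π.withDensity (fun z => ∏ j ∈ Finset.range (i + 1),
        ENNReal.ofReal (h j (z (ix j)) (z (ix (j + 1))))) := by
    intro i
    induction i with
    | zero =>
      intro hi
      have hm := hfmeas 0 hi
      have := hstep 0 hi (fun p => ENNReal.ofReal (h 0 p.1 p.2)) (hhmeas 0 hi).ennreal_ofReal (by
        rw [hmap0, hηprod 0 hi _ (by fun_prop)]
        congr 1
        funext p
        simp only [h, if_true, zero_add]
        congr 1
        rw [div_div, div_div, div_div]
        congr 1
        ring)
      simpa [bigTransport] using this
    | succ i ih =>
      intro hi
      have ih' := ih (by omega)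
      have hm := hfmeas (i + 1) hi
      have hM := hM1 i (by omega)
      have he := hemeas (i + 1) (by omega)
      have hbm := aux_big_meas (k := k) M0 M1 hM0 hM1 i (by omega)
      have hcomp : Measurable (fun p : (Fin n → ℝ) × (Fin n → ℝ) => h (i + 1) (M1 i p.1) p.2) :=
        (hhmeas (i + 1) hi).comp ((hM.comp measurable_fst).prodMk measurable_snd)
      have hcomp' : Measurable (fun p : (Fin n → ℝ) × (Fin n → ℝ) =>
          potential p₀ q g (i + 1) (M1 i p.1) p.2) :=
        hm.comp ((hM.comp measurable_fst).prodMk measurable_snd)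
      have hs := hstep (i + 1) hi (fun p => ENNReal.ofReal (h (i + 1) (M1 i p.1) p.2))
        hcomp.ennreal_ofReal (by
        rw [hmapi (i + 1) (by omega) hi, hηprod (i + 1) hi _ (by
          simp only [Nat.add_sub_cancel]; fun_prop)]
        congr 1
        funext p
        have p1 := hepos (i + 1) (by omega) p.1
        have p2 := hepos (i + 1 + 1) (by omega) p.2
        have p3 := hcpos (i + 1) hi
        simp only [h, Nat.add_sub_cancel, Nat.succ_ne_zero, if_false]
        congr 1
        field_simp)
      have hv : Measurable (fun z : Fin (k + 2) → Fin n → ℝ => ENNReal.ofReal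
          (h (i + 1) (z (ix (i + 1))) (z (ix (i + 1 + 1))))) :=
        ((hhmeas (i + 1) hi).comp
          (hpm (ix (i + 1)) (ix (i + 1 + 1)))).ennreal_ofReal
      have hprodm : Measurable (fun z : Fin (k + 2) → Fin n → ℝ =>
          ∏ j ∈ Finset.range (i + 1), ENNReal.ofReal
            (h j (z (ix j)) (z (ix (j + 1))))) := by
        refine Finset.measurable_prod _ fun j hj => ?_
        have hj' := Finset.mem_range.1 hj
        exact ((hhmeas j (by omega)).comp
          (hpm (ix j) (ix (j + 1)))).ennreal_ofReal
      have hcalc := aux_map_withDensity π (bigTransport (k := k) M0 M1 i) hbm _ hv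
      rw [ih', ← withDensity_mul _ hprodm hv] at hcalc
      simp only [bigTransport]
      rw [← Measure.map_map hbm (aux_step_meas _ _ _ (hM0 _ hi) (hM1 _ hi)), hs]
      have hfun : (fun z : Fin (k + 2) → Fin n → ℝ => ENNReal.ofReal
          (h (i + 1) (M1 i (z (ix (i + 1)))) (z (ix (i + 1 + 1))))) =
          fun z => ENNReal.ofReal (h (i + 1)
            (bigTransport M0 M1 i z (ix (i + 1)))
            (bigTransport M0 M1 i z (ix (i + 1 + 1)))) := by
        funext z
        rw [(aux_big M0 M1 i z _).1 (hcast (i + 1) (by omega)),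
          (aux_big M0 M1 i z _).2 (by rw [hcast (i + 1 + 1) (by omega)]; omega)]
      rw [hfun, hcalc]
      congr 1
      funext z
      rw [Finset.prod_range_succ _ (i + 1)]
      rfl
  -- express the volume through the reference
  have hvol : (volume : Measure (Fin (k + 2) → Fin n → ℝ)) =
      π.withDensity (fun z => ∏ j : Fin (k + 2), ENNReal.ofReal (1 / e j (z j))) := by
    have hle : ∀ j : Fin (k + 2), (j : ℕ) ≤ k + 1 := fun j => by have := j.2; omega
    refine aux_pi_density (fun i : Fin (k + 2) => η i) volume
      (fun j x => ENNReal.ofReal (1 / e j x)) (fun j => ?_) (fun j => ?_)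
    · have := hemeas j (hle j)
      fun_prop
    · have hm := hemeas j (hle j)
      rw [hηd j (hle j), ← withDensity_mul _ (by fun_prop) (by fun_prop)]
      conv_lhs => rw [← withDensity_one (μ := (volume : Measure (Fin n → ℝ)))]
      congr 1
      funext x
      have := hepos j (hle j) x
      simp only [Pi.mul_apply, Pi.one_apply]
      rw [← ENNReal.ofReal_mul this.le, mul_one_div_cancel this.ne', ENNReal.ofReal_one]
  have hem : Measurable (fun z : Fin (k + 2) → Fin n → ℝ =>
      ∏ j : Fin (k + 2), ENNReal.ofReal (1 / e j (z j))) := by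
    refine Finset.measurable_prod _ fun j _ => ?_
    have := hemeas j (by have := j.2; omega)
    fun_prop
  have hρm : Measurable (smoothingDensity (k := k) p₀ q g) := by
    unfold smoothingDensity
    refine Finset.measurable_prod _ fun j _ => ?_
    exact (hfmeas j (by have := j.2; omega)).comp
      (hpm j.castSucc j.succ)
  let C : ℝ := ∏ j : Fin (k + 1), c j
  have hCpos : 0 < C := Finset.prod_pos fun j _ => hcpos j (by have := j.2; omega)
  have hC : Measure.map (bigTransport (k := k) M0 M1 k) π =
      (volume : Measure (Fin (k + 2) → Fin n → ℝ)).withDensity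
        (fun z => ENNReal.ofReal (smoothingDensity (k := k) p₀ q g z / C)) := by
    rw [key k le_rfl, hvol, ← withDensity_mul _ hem (by fun_prop)]
    congr 1
    funext z
    have hep : ∀ j : Fin (k + 2), 0 < e j (z j) := fun j => hepos j (by have := j.2; omega) _
    simp only [Pi.mul_apply]
    rw [← ENNReal.ofReal_prod_of_nonneg (fun j _ => (one_div_pos.2 (hep j)).le),
      ← ENNReal.ofReal_mul (Finset.prod_nonneg fun j _ => (one_div_pos.2 (hep j)).le),
      ← ENNReal.ofReal_prod_of_nonneg (fun j hj =>
        (hhpos j (by have := Finset.mem_range.1 hj; omega) _ _).le)]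
    congr 1
    rw [Finset.prod_range]
    have hterm : ∀ j : Fin (k + 1), h j (z (ix (j : ℕ)))
        (z (ix ((j : ℕ) + 1))) =
        (potential p₀ q g j (z j.castSucc) (z j.succ) / c j) * (1 / e (j.succ : Fin (k + 2)) (z j.succ)) *
          (if j = 0 then 1 / e 0 (z 0) else 1) := by
      intro j
      have h1 : (ix (j : ℕ)) = j.castSucc := by
        rw [Fin.ext_iff, hcast _ (by have := j.2; omega)]; rfl
      have h2 : (ix ((j : ℕ) + 1)) = j.succ := by
        rw [Fin.ext_iff, hcast _ (by have := j.2; omega)]; rfl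
      rw [h1, h2]
      simp only [h, Fin.val_succ]
      by_cases hj : j = 0
      · subst hj
        simp [div_eq_mul_inv]
      · have : (j : ℕ) ≠ 0 := fun hh => hj (Fin.ext hh)
        simp [hj, this, div_eq_mul_inv]
    rw [Finset.prod_congr rfl fun j _ => hterm j, Finset.prod_mul_distrib, Finset.prod_mul_distrib,
      Finset.prod_div_distrib, Fin.prod_univ_succ (n := k + 1), Finset.prod_ite_eq' ]
    simp only [smoothingDensity, C, Finset.mem_univ, if_true, Fin.val_zero]
    ring
  have hCeq : C = ∫ z, smoothingDensity (k := k) p₀ q g z := by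
    have hbm := aux_big_meas (k := k) M0 M1 hM0 hM1 k le_rfl
    have h1 := congrArg (fun m => m Set.univ) hC
    simp only [Measure.map_apply hbm MeasurableSet.univ, Set.preimage_univ,
      withDensity_apply _ MeasurableSet.univ, Measure.restrict_univ] at h1
    rw [← ofReal_integral_eq_lintegral_ofReal (hρint.div_const C)
      (Filter.Eventually.of_forall fun z => (div_pos (hρpos z) hCpos).le), integral_div] at h1
    have h2 : π Set.univ = 1 := measure_univ
    rw [h2] at h1
    have h3 := ENNReal.ofReal_eq_one.1 h1.symm
    rw [div_eq_one_iff_eq hCpos.ne'] at h3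
    exact h3.symm
  rw [← hCeq]
  exact hC
end

section
/- Let n ≥ 1, F ∈ ℝ^{n×n}, Q ∈ ℝ^{n×n} positive definite, H ∈ ℝ^{d×n}, R ∈ ℝ^{d×d} positive definite, y ∈ ℝᵈ, c' ∈ ℝⁿ and C' ∈ ℝ^{n×n}. Set J₁₁ = I + C'ᵀ Fᵀ Q⁻¹ F C', J₁₂ = −C'ᵀ Fᵀ Q⁻¹, J₂₂ = Q⁻¹ + Hᵀ R⁻¹ H, h₁ = J₁₂ F c', h₂ = Q⁻¹ F c' + Hᵀ R⁻¹ y, and let J be the 2n×2n block matrix [[J₁₁, J₁₂],[J₁₂ᵀ, J₂₂]] and h = (h₁, h₂) ∈ ℝ²ⁿ. Then J is positive definite, the function z ↦ exp(−½ zᵀ J z + hᵀ z) on ℝ²ⁿ is integrable with positive integral, and, writing π^k for the probability measure on ℝⁿ × ℝⁿ with density proportional to exp(−½ zᵀ J z + hᵀ z), the following holds: if c ∈ ℝⁿ and C ∈ ℝ^{n×n} are such that the affine map z ↦ C z + c pushes the standard normal measure on ℝⁿ forward to the second-block marginal of π^k, and A ∈ ℝ^{n×n} is any matrix with A Aᵀ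 = J₁₁⁻¹, then with B = −J₁₁⁻¹ J₁₂ C and a = J₁₁⁻¹ J₁₂ (F c' − c), the map M(z_k, z_{k+1}) = (A z_k + B z_{k+1} + a, C z_{k+1} + c) pushes the standard normal measure on ℝ²ⁿ forward to π^k. -/
open MeasureTheory ProbabilityTheory Matrix

/-- The standard normal measure on `ℝᵐ`, the product of `m` copies of the
one-dimensional standard Gaussian. -/
noncomputable def stdGaussianPi (m : ℕ) : Measure (Fin m → ℝ) :=
  Measure.pi fun _ : Fin m => gaussianReal 0 1

lemma aux_map_wd {α β : Type*} [MeasurableSpace α] [MeasurableSpace β] (μ : Measure α)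
    (T : α → β) (hT : Measurable T) (g : β → ENNReal) (hg : Measurable g) :
    Measure.map T (μ.withDensity (fun x => g (T x))) = (Measure.map T μ).withDensity g := by
  ext s hs
  rw [Measure.map_apply hT hs, withDensity_apply _ (hT hs), withDensity_apply _ hs,
    setLIntegral_map hs hg hT]

lemma aux_key (n : ℕ) (f G : (Fin n → ℝ) → ENNReal) (hf : Measurable f) (hG : Measurable G)
    (m : (Fin n → ℝ) → (Fin n → ℝ)) (hm : Measurable m) :
    Measure.map (fun z : (Fin n → ℝ) × (Fin n → ℝ) => (z.1 + m z.2, z.2))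
      (((volume : Measure (Fin n → ℝ)).withDensity f).prod
        ((volume : Measure (Fin n → ℝ)).withDensity G)) =
    (volume : Measure ((Fin n → ℝ) × (Fin n → ℝ))).withDensity
      (fun z => f (z.1 - m z.2) * G z.2) := by
  have hT : Measurable (fun z : (Fin n → ℝ) × (Fin n → ℝ) => (z.1 + m z.2, z.2)) := by fun_prop
  have hg : Measurable (fun z : (Fin n → ℝ) × (Fin n → ℝ) => f (z.1 - m z.2) * G z.2) := by
    fun_prop
  rw [prod_withDensity hf hG]
  have h1 := aux_map_wd ((volume : Measure (Fin n → ℝ)).prod (volume : Measure (Fin n → ℝ)))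
    _ hT _ hg
  simp only [add_sub_cancel_right] at h1
  rw [h1]
  congr 1
  ext s hs
  rw [Measure.map_apply hT hs, Measure.volume_eq_prod, Measure.prod_apply_symm (hT hs),
    Measure.prod_apply_symm hs]
  refine lintegral_congr fun w => ?_
  exact measure_preimage_add_right (volume : Measure (Fin n → ℝ)) (m w) ((fun x => (x, w)) ⁻¹' s)

lemma aux_std (n : ℕ) : ∃ K : ℝ, 0 < K ∧ stdGaussianPi n =
    (volume : Measure (Fin n → ℝ)).withDensity
      (fun x => ENNReal.ofReal (K * Real.exp (-(1 / 2) * (x ⬝ᵥ x)))) := by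
  refine ⟨((Real.sqrt (2 * Real.pi))⁻¹) ^ n, by positivity, ?_⟩
  have hfun : ∀ x : Fin n → ℝ, ((Real.sqrt (2 * Real.pi))⁻¹) ^ n *
      Real.exp (-(1 / 2) * (x ⬝ᵥ x)) = ∏ i, gaussianPDFReal 0 1 (x i) := by
    intro x
    simp only [gaussianPDFReal, Finset.prod_mul_distrib, ← Real.exp_sum]
    simp only [NNReal.coe_one, mul_one, Finset.prod_const, Finset.card_univ, Fintype.card_fin,
      sub_zero, dotProduct, Finset.mul_sum]
    congr 2
    refine Finset.sum_congr rfl fun i _ => ?_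
    ring
  simp only [hfun]
  unfold stdGaussianPi
  refine Measure.pi_eq fun s hs => ?_
  rw [withDensity_apply _ (MeasurableSet.univ_pi hs)]
  rw [volume_pi, Measure.restrict_pi_pi,
    ← ofReal_integral_eq_lintegral_ofReal, integral_fintype_prod_eq_prod
      (f := fun _ t => gaussianPDFReal 0 1 t),
    ENNReal.ofReal_prod_of_nonneg]
  · refine Finset.prod_congr rfl fun i _ => ?_
    rw [gaussianReal_apply_eq_integral 0 one_ne_zero]
  · intro i _
    exact integral_nonneg fun x => gaussianPDFReal_nonneg _ _ _
  · exact Integrable.fintype_prod fun i => (integrable_gaussianPDFReal 0 1).restrict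
  · exact Filter.Eventually.of_forall fun x =>
      Finset.prod_nonneg fun i _ => gaussianPDFReal_nonneg _ _ _

lemma aux_lin (n : ℕ) (J A : Matrix (Fin n) (Fin n) ℝ) (hJ : IsUnit J.det)
    (hA : A * Aᵀ = J⁻¹) :
    ∃ K : ℝ, 0 < K ∧ Measure.map (fun x => A *ᵥ x) (stdGaussianPi n) =
    (volume : Measure (Fin n → ℝ)).withDensity
      (fun x => ENNReal.ofReal (K * Real.exp (-(1 / 2) * (x ⬝ᵥ (J *ᵥ x))))) := by
  obtain ⟨K, hK, hstd⟩ := aux_std n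
  have h1 : A * (Aᵀ * J) = 1 := by rw [← mul_assoc, hA, Matrix.nonsing_inv_mul _ hJ]
  have h2 : Aᵀ * J * A = 1 := mul_eq_one_comm.mp h1
  have hdet : A.det ≠ 0 := by
    intro h0
    have := congrArg Matrix.det h1
    rw [Matrix.det_mul, h0] at this
    simp at this
  have hAm : Measurable (fun x : Fin n → ℝ => A *ᵥ x) :=
    (Continuous.matrix_mulVec continuous_const continuous_id).measurable
  have hg : Measurable (fun x : Fin n → ℝ =>
      ENNReal.ofReal (K * Real.exp (-(1 / 2) * (x ⬝ᵥ (J *ᵥ x))))) := by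
    have : Continuous (fun x : Fin n → ℝ => x ⬝ᵥ (J *ᵥ x)) := by fun_prop
    have := this.measurable
    fun_prop
  have h3 := aux_map_wd (volume : Measure (Fin n → ℝ)) _ hAm _ hg
  have h4 : ∀ x : Fin n → ℝ, (A *ᵥ x) ⬝ᵥ (J *ᵥ (A *ᵥ x)) = x ⬝ᵥ x := by
    intro x
    rw [Matrix.mulVec_mulVec, ← Matrix.vecMul_transpose A x, ← Matrix.dotProduct_mulVec,
      Matrix.mulVec_mulVec, ← mul_assoc, h2, Matrix.one_mulVec]
  simp only [h4] at h3
  have h5 : Measure.map (fun x : Fin n → ℝ => A *ᵥ x) volume =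
      ENNReal.ofReal |A.det⁻¹| • volume := by
    have := Real.map_matrix_volume_pi_eq_smul_volume_pi hdet
    exact this
  refine ⟨|A.det⁻¹| * K, by positivity, ?_⟩
  rw [hstd, h3, h5, withDensity_smul_measure, ← withDensity_smul _ hg]
  congr 1
  ext x
  simp only [Pi.smul_apply, smul_eq_mul, mul_assoc]
  rw [← ENNReal.ofReal_mul (abs_nonneg _)]

open scoped MatrixOrder in
lemma aux_int {ι : Type*} [Fintype ι] [DecidableEq ι] (J : Matrix ι ι ℝ) (hJ : J.PosDef)
    (h : ι → ℝ) :
    Integrable (fun x : ι → ℝ => Real.exp (-(1 / 2) * (x ⬝ᵥ (J *ᵥ x)) + h ⬝ᵥ x)) := by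
  obtain ⟨B, hB⟩ := CStarAlgebra.nonneg_iff_eq_star_mul_self.mp hJ.posSemidef.nonneg
  rw [Matrix.star_eq_conjTranspose, Matrix.conjTranspose_eq_transpose_of_trivial] at hB
  have hdet : B.det ≠ 0 := by
    intro h0
    have := hJ.det_pos
    rw [hB, Matrix.det_mul, h0] at this
    simp at this
  have hBm : Measurable (fun x : ι → ℝ => B *ᵥ x) :=
    (Continuous.matrix_mulVec continuous_const continuous_id).measurable
  have h5 : Measure.map (fun x : ι → ℝ => B *ᵥ x) volume =
      ENNReal.ofReal |B.det⁻¹| • volume := by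
    have := Real.map_matrix_volume_pi_eq_smul_volume_pi hdet
    exact this
  set k := h ᵥ* B⁻¹ with hk
  have hφ : Integrable (fun x : ι → ℝ => Real.exp (-(1 / 2) * (x ⬝ᵥ x) + k ⬝ᵥ x)) := by
    have : (fun x : ι → ℝ => Real.exp (-(1 / 2) * (x ⬝ᵥ x) + k ⬝ᵥ x)) =
        fun x => ∏ i, Real.exp (-(1 / 2) * (x i) ^ 2 + k i * x i) := by
      ext x
      rw [← Real.exp_sum, Finset.sum_add_distrib, ← Finset.mul_sum]
      simp only [dotProduct, pow_two]
    rw [this]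
    refine Integrable.fintype_prod (f := fun i t => Real.exp (-(1 / 2) * t ^ 2 + k i * t))
      fun i => ?_
    have hc := integrable_cexp_quadratic (b := (1 / 2 : ℂ)) (by norm_num) (k i : ℂ) 0
    have := hc.norm
    refine this.congr (Filter.Eventually.of_forall fun t => ?_)
    simp only [Complex.norm_exp]
    congr 1
    have : (-(1 / 2 : ℂ) * (t : ℂ) ^ 2 + (k i : ℂ) * (t : ℂ) + 0) =
        ((-(1 / 2) * t ^ 2 + k i * t : ℝ) : ℂ) := by push_cast; ring
    rw [this, Complex.ofReal_re]
  have h6 := (hφ.smul_measure (c := ENNReal.ofReal |B.det⁻¹|) ENNReal.ofReal_ne_top)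
  rw [← h5] at h6
  have h7 := h6.comp_measurable hBm
  refine h7.congr (Filter.Eventually.of_forall fun x => ?_)
  simp only [Function.comp]
  congr 2
  · rw [hB, ← Matrix.mulVec_mulVec, Matrix.dotProduct_mulVec x, Matrix.vecMul_transpose]
  · rw [hk, ← Matrix.dotProduct_mulVec, Matrix.mulVec_mulVec,
      Matrix.nonsing_inv_mul _ (isUnit_iff_ne_zero.mpr hdet), Matrix.one_mulVec]

/-- **The linear Gaussian (square-root Rauch–Tung–Striebel) case.**
With the information-form target `π^k ∝ exp(−½ zᵀ J z + hᵀ z)` built from the Kalman filtering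
quantities, `J` is positive definite, the unnormalized density is integrable with positive mass,
and if `z ↦ C z + c` pushes the standard normal forward to the second-block marginal of `π^k`
and `A Aᵀ = J₁₁⁻¹`, then the block upper triangular affine map
`M(z_k, z_{k+1}) = (A z_k + B z_{k+1} + a, C z_{k+1} + c)` with `B = −J₁₁⁻¹ J₁₂ C` and
`a = J₁₁⁻¹ J₁₂ (F c' − c)` pushes the standard normal on `ℝ²ⁿ` forward to `π^k`. -/
theorem linear_gaussian_RTS_step
    (n d : ℕ) (hn : 0 < n)
    (F Q : Matrix (Fin n) (Fin n) ℝ) (hQ : Q.PosDef)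
    (H : Matrix (Fin d) (Fin n) ℝ) (R : Matrix (Fin d) (Fin d) ℝ) (hR : R.PosDef)
    (y : Fin d → ℝ) (c' : Fin n → ℝ) (C' : Matrix (Fin n) (Fin n) ℝ)
    (J11 J12 J22 : Matrix (Fin n) (Fin n) ℝ) (h1 h2 : Fin n → ℝ)
    (hJ11 : J11 = 1 + C'ᵀ * Fᵀ * Q⁻¹ * F * C')
    (hJ12 : J12 = -(C'ᵀ * Fᵀ * Q⁻¹))
    (hJ22 : J22 = Q⁻¹ + Hᵀ * R⁻¹ * H)
    (hh1 : h1 = J12 *ᵥ (F *ᵥ c'))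
    (hh2 : h2 = Q⁻¹ *ᵥ (F *ᵥ c') + Hᵀ *ᵥ (R⁻¹ *ᵥ y))
    (J : Matrix (Fin n ⊕ Fin n) (Fin n ⊕ Fin n) ℝ)
    (hJ : J = Matrix.fromBlocks J11 J12 J12ᵀ J22)
    (dens : (Fin n → ℝ) × (Fin n → ℝ) → ℝ)
    (hdens : ∀ z : (Fin n → ℝ) × (Fin n → ℝ),
      dens z = Real.exp (-(1 / 2) * (Sum.elim z.1 z.2 ⬝ᵥ (J *ᵥ Sum.elim z.1 z.2)) +
        Sum.elim h1 h2 ⬝ᵥ Sum.elim z.1 z.2)) :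
    J.PosDef ∧
    Integrable dens ∧
    0 < ∫ z, dens z ∧
    ∀ (cv : Fin n → ℝ) (C A : Matrix (Fin n) (Fin n) ℝ),
      Measure.map (fun x => C *ᵥ x + cv) (stdGaussianPi n) =
        Measure.map Prod.snd
          ((volume : Measure ((Fin n → ℝ) × (Fin n → ℝ))).withDensity
            (fun z => ENNReal.ofReal (dens z / ∫ z, dens z))) →
      A * Aᵀ = J11⁻¹ →
      Measure.map
          (fun zp : (Fin n → ℝ) × (Fin n → ℝ) =>
            (A *ᵥ zp.1 + (-(J11⁻¹ * J12 * C)) *ᵥ zp.2 + (J11⁻¹ * J12) *ᵥ (F *ᵥ c' - cv),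
              C *ᵥ zp.2 + cv))
          ((stdGaussianPi n).prod (stdGaussianPi n)) =
        (volume : Measure ((Fin n → ℝ) × (Fin n → ℝ))).withDensity
          (fun z => ENNReal.ofReal (dens z / ∫ z, dens z)) := by
  have hQi : Q⁻¹.PosDef := hQ.inv
  have hRi : R⁻¹.PosDef := hR.inv
  have hQs : Q⁻¹ᵀ = Q⁻¹ := by simpa [Matrix.IsSymm] using hQi.1
  have hRs : R⁻¹ᵀ = R⁻¹ := by simpa [Matrix.IsSymm] using hRi.1
  have hQnn : ∀ x, 0 ≤ x ⬝ᵥ (Q⁻¹ *ᵥ x) := fun x => by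
    simpa using hQi.posSemidef.dotProduct_mulVec_nonneg x
  have hRnn : ∀ x, 0 ≤ x ⬝ᵥ (R⁻¹ *ᵥ x) := fun x => by
    simpa using hRi.posSemidef.dotProduct_mulVec_nonneg x
  have htr : ∀ {p q : ℕ} (M : Matrix (Fin p) (Fin q) ℝ) (u : Fin q → ℝ) (v : Fin p → ℝ),
      u ⬝ᵥ (Mᵀ *ᵥ v) = (M *ᵥ u) ⬝ᵥ v := by
    intro p q M u v
    rw [Matrix.dotProduct_mulVec, Matrix.vecMul_transpose]
  have hJ11s : J11ᵀ = J11 := by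
    rw [hJ11]
    simp only [Matrix.transpose_add, Matrix.transpose_one, Matrix.transpose_mul,
      Matrix.transpose_transpose, hQs, Matrix.mul_assoc]
  have hJ22s : J22ᵀ = J22 := by
    rw [hJ22]
    simp only [Matrix.transpose_add, Matrix.transpose_mul,
      Matrix.transpose_transpose, hQs, hRs, Matrix.mul_assoc]
  have hquad : ∀ a b : Fin n → ℝ, Sum.elim a b ⬝ᵥ (J *ᵥ Sum.elim a b) =
      a ⬝ᵥ (J11 *ᵥ a) + 2 * (a ⬝ᵥ (J12 *ᵥ b)) + b ⬝ᵥ (J22 *ᵥ b) := by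
    intro a b
    rw [hJ, Matrix.fromBlocks_mulVec, sumElim_dotProduct_sumElim]
    simp only [Sum.elim_comp_inl, Sum.elim_comp_inr, dotProduct_add]
    rw [htr J12 b a, dotProduct_comm (J12 *ᵥ b) a]
    ring
  have hquad11 : ∀ a : Fin n → ℝ, a ⬝ᵥ (J11 *ᵥ a) =
      a ⬝ᵥ a + (F *ᵥ (C' *ᵥ a)) ⬝ᵥ (Q⁻¹ *ᵥ (F *ᵥ (C' *ᵥ a))) := by
    intro a
    rw [hJ11, Matrix.add_mulVec, Matrix.one_mulVec, dotProduct_add]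
    simp only [← Matrix.mulVec_mulVec, htr]
  have hquad12 : ∀ a b : Fin n → ℝ, a ⬝ᵥ (J12 *ᵥ b) =
      - ((F *ᵥ (C' *ᵥ a)) ⬝ᵥ (Q⁻¹ *ᵥ b)) := by
    intro a b
    rw [hJ12, Matrix.neg_mulVec, dotProduct_neg]
    simp only [← Matrix.mulVec_mulVec, htr]
  have hquad22 : ∀ b : Fin n → ℝ, b ⬝ᵥ (J22 *ᵥ b) =
      b ⬝ᵥ (Q⁻¹ *ᵥ b) + (H *ᵥ b) ⬝ᵥ (R⁻¹ *ᵥ (H *ᵥ b)) := by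
    intro b
    rw [hJ22, Matrix.add_mulVec, dotProduct_add]
    simp only [← Matrix.mulVec_mulVec, htr]
  have hself : ∀ a : Fin n → ℝ, a ≠ 0 → 0 < a ⬝ᵥ a := fun a ha => by
    simpa using (Matrix.dotProduct_star_self_pos_iff (v := a)).mpr ha
  have hself0 : ∀ a : Fin n → ℝ, 0 ≤ a ⬝ᵥ a := fun a => by
    simpa using dotProduct_star_self_nonneg a
  have hJ11pd : J11.PosDef := by
    refine Matrix.PosDef.of_dotProduct_mulVec_pos (by simpa [Matrix.IsHermitian] using hJ11s) ?_
    intro a ha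
    rw [star_trivial, hquad11]
    linarith [hself a ha, hQnn (F *ᵥ (C' *ᵥ a))]
  have hJ11u : IsUnit J11.det := hJ11pd.det_pos.ne'.isUnit
  have hJpd : J.PosDef := by
    refine Matrix.PosDef.of_dotProduct_mulVec_pos ?_ ?_
    · rw [Matrix.IsHermitian, Matrix.conjTranspose_eq_transpose_of_trivial, hJ,
        Matrix.fromBlocks_transpose, hJ11s, hJ22s, Matrix.transpose_transpose]
    · intro x hx
      obtain ⟨a, b, rfl⟩ : ∃ a b, x = Sum.elim a b :=
        ⟨x ∘ Sum.inl, x ∘ Sum.inr, (Sum.elim_comp_inl_inr x).symm⟩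
      rw [star_trivial, hquad, hquad11, hquad12, hquad22]
      by_cases ha : a = 0
      · have hb : b ≠ 0 := by
          rintro rfl
          apply hx
          subst ha
          ext i; cases i <;> rfl
        have hb2 := hQi.dotProduct_mulVec_pos hb
        rw [star_trivial] at hb2
        subst ha
        simp only [Matrix.mulVec_zero, zero_dotProduct]
        linarith [hRnn (H *ᵥ b)]
      · have h3 := hQnn (F *ᵥ (C' *ᵥ a) - b)
        have hsy : b ⬝ᵥ (Q⁻¹ *ᵥ (F *ᵥ (C' *ᵥ a))) = (F *ᵥ (C' *ᵥ a)) ⬝ᵥ (Q⁻¹ *ᵥ b) := by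
          conv_lhs => rw [← hQs, htr, dotProduct_comm]
        rw [Matrix.mulVec_sub, sub_dotProduct, dotProduct_sub, dotProduct_sub, hsy] at h3
        linarith [hself a ha, hRnn (H *ᵥ b)]
  have hint : Integrable dens := by
    have h1 := aux_int J hJpd (Sum.elim h1 h2)
    have h2 := volume_measurePreserving_sumPiEquivProdPi_symm (fun _ : Fin n ⊕ Fin n => ℝ)
    have h3 := h2.integrable_comp_of_integrable h1
    refine h3.congr (Filter.Eventually.of_forall fun z => ?_)
    rw [hdens]
    have : (MeasurableEquiv.sumPiEquivProdPi (fun _ : Fin n ⊕ Fin n => ℝ)).symm z =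
        Sum.elim z.1 z.2 := by
      ext i; cases i <;> rfl
    simp only [Function.comp, this]
  have hZ : 0 < ∫ z, dens z := by
    rw [integral_pos_iff_support_of_nonneg (fun z => by rw [hdens]; exact (Real.exp_pos _).le) hint]
    have : Function.support dens = Set.univ := by
      ext z; simp [hdens, Real.exp_ne_zero]
    rw [this]
    exact isOpen_univ.measure_pos _ Set.univ_nonempty
  refine ⟨hJpd, hint, hZ, ?_⟩
  intro cv C A hmarg hA
  generalize (∫ z, dens z) = Z at hZ hmarg ⊢
  obtain ⟨K, hK, hν⟩ := aux_lin n J11 A hJ11u hA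
  set m : (Fin n → ℝ) → (Fin n → ℝ) := fun w => (J11⁻¹ * J12) *ᵥ (F *ᵥ c' - w) with hm
  have hmc : Continuous m := by fun_prop
  have hJm : ∀ w, J11 *ᵥ m w = h1 - J12 *ᵥ w := by
    intro w
    rw [hm, hh1]
    simp only [Matrix.mulVec_mulVec, ← mul_assoc]
    rw [Matrix.mul_nonsing_inv _ hJ11u, one_mul, Matrix.mulVec_sub, Matrix.mulVec_mulVec]
  have hfac : ∀ z : (Fin n → ℝ) × (Fin n → ℝ), dens z =
      Real.exp (-(1 / 2) * ((z.1 - m z.2) ⬝ᵥ (J11 *ᵥ (z.1 - m z.2)))) * dens (m z.2, z.2) := by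
    rintro ⟨z1, w⟩
    obtain ⟨u, rfl⟩ : ∃ u, z1 = u + m w := ⟨z1 - m w, by simp⟩
    rw [hdens, hdens, ← Real.exp_add]
    congr 1
    simp only [hquad, sumElim_dotProduct_sumElim, add_sub_cancel_right]
    have hs : m w ⬝ᵥ (J11 *ᵥ u) = u ⬝ᵥ (J11 *ᵥ m w) := by
      conv_lhs => rw [← hJ11s, htr, dotProduct_comm]
    have e1 : u ⬝ᵥ (J11 *ᵥ m w) = h1 ⬝ᵥ u - u ⬝ᵥ (J12 *ᵥ w) := by
      rw [hJm, dotProduct_sub, dotProduct_comm u h1]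
    simp only [Matrix.mulVec_add, add_dotProduct, dotProduct_add, hs, e1]
    ring
  have hdc : Continuous dens := by
    have : dens = fun z => Real.exp (-(1 / 2) * (z.1 ⬝ᵥ (J11 *ᵥ z.1) +
        2 * (z.1 ⬝ᵥ (J12 *ᵥ z.2)) + z.2 ⬝ᵥ (J22 *ᵥ z.2)) + (h1 ⬝ᵥ z.1 + h2 ⬝ᵥ z.2)) := by
      ext z
      rw [hdens, hquad, sumElim_dotProduct_sumElim]
    rw [this]
    fun_prop
  set f : (Fin n → ℝ) → ENNReal := fun x =>
    ENNReal.ofReal (K * Real.exp (-(1 / 2) * (x ⬝ᵥ (J11 *ᵥ x)))) with hf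
  set G : (Fin n → ℝ) → ENNReal := fun w => ENNReal.ofReal (dens (m w, w) / (Z * K)) with hG
  have hfm : Measurable f := by
    have : Continuous (fun x : Fin n → ℝ => x ⬝ᵥ (J11 *ᵥ x)) := by fun_prop
    have := this.measurable
    fun_prop
  have hGm : Measurable G := by
    have : Continuous (fun w => dens (m w, w)) := by fun_prop
    have := this.measurable
    fun_prop
  have hpi : (fun z => ENNReal.ofReal (dens z / Z)) = fun z => f (z.1 - m z.2) * G z.2 := by
    ext z
    rw [hf, hG]
    simp only
    rw [← ENNReal.ofReal_mul (by positivity)]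
    congr 1
    rw [hfac z]
    field_simp
  have hkey := aux_key n f G hfm hGm m hmc.measurable
  rw [hpi, ← hkey] at hmarg ⊢
  have hAm : Measurable (fun x : Fin n → ℝ => A *ᵥ x) :=
    (Continuous.matrix_mulVec continuous_const continuous_id).measurable
  have hCm : Measurable (fun x : Fin n → ℝ => C *ᵥ x + cv) :=
    ((Continuous.matrix_mulVec continuous_const continuous_id).add continuous_const).measurable
  have : IsProbabilityMeasure (stdGaussianPi n) := by
    unfold stdGaussianPi; infer_instance
  have hTm : Measurable (fun z : (Fin n → ℝ) × (Fin n → ℝ) => (z.1 + m z.2, z.2)) := by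
    have := hmc.measurable
    fun_prop
  rw [← hν] at hmarg ⊢
  have : IsProbabilityMeasure (Measure.map (fun x => A *ᵥ x) (stdGaussianPi n)) :=
    Measure.isProbabilityMeasure_map hAm.aemeasurable
  rw [Measure.map_map measurable_snd hTm] at hmarg
  have hsnd : (Prod.snd ∘ fun z : (Fin n → ℝ) × (Fin n → ℝ) => (z.1 + m z.2, z.2)) = Prod.snd :=
    rfl
  rw [hsnd, Measure.map_snd_prod, measure_univ, one_smul] at hmarg
  rw [← hmarg, Measure.map_prod_map _ _ hAm hCm, Measure.map_map hTm (hAm.prodMap hCm)]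
  congr 1
  ext1 z
  simp only [Function.comp, Prod.map, hm, Prod.mk.injEq, and_true]
  rw [Matrix.neg_mulVec, ← Matrix.mulVec_mulVec z.2 (J11⁻¹ * J12) C]
  simp only [Matrix.mulVec_sub, Matrix.mulVec_add]
  abel
end

section
/- Let n ≥ 1 and let μ and ν be Borel probability measures on ℝⁿ = (Fin n → ℝ), each absolutely continuous with respect to Lebesgue measure with an almost-everywhere strictly positive density. Then there exists a lower triangular, monotone increasing map T : ℝⁿ → ℝⁿ (the Knothe–Rosenblatt rearrangement) such that Measure.map T μ = ν; moreover any two lower triangular, monotone increasing maps pushing μ forward to ν agree μ-almost everywhere. -/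
open MeasureTheory

/-- A map `T : ℝⁿ → ℝⁿ` is lower triangular if its `k`-th component depends only on the
first `k` coordinates. -/
def LowerTriangular {n : ℕ} (T : (Fin n → ℝ) → (Fin n → ℝ)) : Prop :=
  ∀ (k : Fin n) (x y : Fin n → ℝ), (∀ j : Fin n, j ≤ k → x j = y j) → T x k = T y k

/-- A map `T : ℝⁿ → ℝⁿ` is monotone increasing if each diagonal section
`t ↦ T (update x k t) k` is strictly increasing. -/
def MonotoneIncreasingMap {n : ℕ} (T : (Fin n → ℝ) → (Fin n → ℝ)) : Prop :=
  ∀ (k : Fin n) (x : Fin n → ℝ), StrictMono (fun t => T (Function.update x k t) k)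

section KR
open ProbabilityTheory Set Filter Topology

lemma kr_cdf_strictMono (α : Measure ℝ) [IsProbabilityMeasure α]
    (h2 : (volume : Measure ℝ) ≪ α) : StrictMono (cdf α) := by
  intro a b hab
  by_contra hle
  push Not at hle
  have h : α (Ioc a b) = 0 := by
    rw [← measure_cdf α, StieltjesFunction.measure_Ioc]
    simpa using hle
  have := h2 h
  simp at this
  linarith

lemma kr_cdf_continuous (α : Measure ℝ) [IsProbabilityMeasure α]
    (h1 : α ≪ volume) : Continuous (cdf α) := by
  rw [continuous_iff_continuousAt]
  intro a
  rw [(monotone_cdf α).continuousAt_iff_leftLim_eq_rightLim, StieltjesFunction.rightLim_eq]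
  have h : α {a} = 0 := h1 (by simp)
  rw [← measure_cdf α, StieltjesFunction.measure_singleton] at h
  have h3 := (monotone_cdf α).leftLim_le (le_refl a)
  simp at h
  linarith

lemma kr_cdf_range (α : Measure ℝ) [IsProbabilityMeasure α]
    (h1 : α ≪ volume) {c : ℝ} (h0 : 0 < c) (hc : c < 1) : ∃ s, cdf α s = c := by
  obtain ⟨a, ha⟩ := ((tendsto_cdf_atBot α).eventually_lt_const h0).exists
  obtain ⟨b, hb⟩ := ((tendsto_cdf_atTop α).eventually_const_lt hc).exists
  exact mem_range_of_exists_le_of_exists_ge (kr_cdf_continuous α h1) ⟨a, ha.le⟩ ⟨b, hb.le⟩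

lemma kr_cdf_pos (α : Measure ℝ) [IsProbabilityMeasure α]
    (h2 : (volume : Measure ℝ) ≪ α) (s : ℝ) : 0 < cdf α s :=
  (cdf_nonneg α (s - 1)).trans_lt (kr_cdf_strictMono α h2 (by linarith))

lemma kr_cdf_lt_one (α : Measure ℝ) [IsProbabilityMeasure α]
    (h2 : (volume : Measure ℝ) ≪ α) (s : ℝ) : cdf α s < 1 :=
  (kr_cdf_strictMono α h2 (show s < s + 1 by linarith)).trans_le (cdf_le_one α _)

lemma kr_one_dim (α β : Measure ℝ) [IsProbabilityMeasure α] [IsProbabilityMeasure β]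
    (ha1 : α ≪ volume) (ha2 : (volume : Measure ℝ) ≪ α)
    (hb1 : β ≪ volume) (hb2 : (volume : Measure ℝ) ≪ β) :
    ∃ τ : ℝ → ℝ, StrictMono τ ∧ (∀ s b, τ s ≤ b ↔ cdf α s ≤ cdf β b) ∧ α.map τ = β := by
  have : ∀ s, ∃ r, cdf β r = cdf α s := fun s =>
    kr_cdf_range β hb1 (kr_cdf_pos α ha2 s) (kr_cdf_lt_one α ha2 s)
  choose τ hτ using this
  have hsa := kr_cdf_strictMono α ha2
  have hsb := kr_cdf_strictMono β hb2
  have hm : StrictMono τ := by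
    intro s t hst
    rw [← hsb.lt_iff_lt, hτ, hτ]
    exact hsa hst
  have hle : ∀ s b, τ s ≤ b ↔ cdf α s ≤ cdf β b := by
    intro s b
    rw [← hsb.le_iff_le, hτ]
  refine ⟨τ, hm, hle, ?_⟩
  have : IsProbabilityMeasure (α.map τ) :=
    Measure.isProbabilityMeasure_map hm.monotone.measurable.aemeasurable
  apply Measure.ext_of_Iic
  intro b
  rw [Measure.map_apply hm.monotone.measurable measurableSet_Iic]
  obtain ⟨s, hs⟩ := kr_cdf_range α ha1 (kr_cdf_pos β hb2 b) (kr_cdf_lt_one β hb2 b)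
  have : τ ⁻¹' Iic b = Iic s := by
    ext r
    simp only [mem_preimage, mem_Iic, hle, ← hs, hsa.le_iff_le]
  rw [this, ← ofReal_cdf, ← ofReal_cdf, hs]

lemma kr_exists_prod {X Y : Type*} [MeasurableSpace X] [MeasurableSpace Y]
    (ρ : Measure X) (ρ' : Measure Y) [IsProbabilityMeasure ρ] [IsProbabilityMeasure ρ']
    (κ : Kernel X ℝ) (κ' : Kernel Y ℝ) [IsMarkovKernel κ] [IsMarkovKernel κ']
    (T : X → Y) (hT : Measurable T) (hmap : ρ.map T = ρ')
    (h1 : ∀ᵐ x ∂ρ, κ x ≪ volume ∧ (volume : Measure ℝ) ≪ κ x)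
    (h2 : ∀ᵐ x ∂ρ', κ' x ≪ volume ∧ (volume : Measure ℝ) ≪ κ' x) :
    ∃ t : X → ℝ → ℝ, (Measurable fun p : X × ℝ => t p.1 p.2) ∧ (∀ x, StrictMono (t x)) ∧
      (ρ ⊗ₘ κ).map (fun p => (T p.1, t p.1 p.2)) = ρ' ⊗ₘ κ' := by
  classical
  have h3 : ∀ᵐ x ∂ρ, (κ x ≪ volume ∧ (volume : Measure ℝ) ≪ κ x) ∧
      (κ' (T x) ≪ volume ∧ (volume : Measure ℝ) ≪ κ' (T x)) := by
    rw [← hmap] at h2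
    filter_upwards [h1, ae_of_ae_map hT.aemeasurable h2] with x hx hx'
    exact ⟨hx, hx'⟩
  obtain ⟨G, hGae, hGm, hG⟩ := h3.exists_measurable_mem
  have key : ∀ x, ∃ τ : ℝ → ℝ, StrictMono τ ∧ (x ∈ G →
      (∀ s b, τ s ≤ b ↔ cdf (κ x) s ≤ cdf (κ' (T x)) b) ∧ (κ x).map τ = κ' (T x)) ∧
      (x ∉ G → τ = id) := by
    intro x
    by_cases hx : x ∈ G
    · obtain ⟨⟨a, b⟩, c, d⟩ := hG x hx
      obtain ⟨τ, h1, h2⟩ := kr_one_dim (κ x) (κ' (T x)) a b c d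
      exact ⟨τ, h1, fun _ => h2, fun h => absurd hx h⟩
    · exact ⟨id, strictMono_id, fun h => absurd h hx, fun _ => rfl⟩
  choose t ht1 ht2 ht3 using key
  have hF : Measurable fun p : X × ℝ => cdf (κ p.1) p.2 := by
    simp_rw [cdf_eq_real, Measure.real]
    refine Measurable.ennreal_toReal ?_
    have := Kernel.measurable_kernel_prodMk_left (κ := κ.comap Prod.fst (measurable_fst (β := ℝ)))
      (t := {q : (X × ℝ) × ℝ | q.2 ≤ q.1.2})
      (measurableSet_le measurable_snd (measurable_snd.comp measurable_fst))
    exact this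
  have hFb : ∀ b : ℝ, Measurable fun y : Y => cdf (κ' y) b := by
    intro b
    simp_rw [cdf_eq_real, Measure.real]
    exact (κ'.measurable_coe measurableSet_Iic).ennreal_toReal
  have htm : Measurable fun p : X × ℝ => t p.1 p.2 := by
    apply measurable_of_Iic
    intro b
    have : (fun p : X × ℝ => t p.1 p.2) ⁻¹' Iic b =
        (Prod.fst ⁻¹' G ∩ {p : X × ℝ | cdf (κ p.1) p.2 ≤ cdf (κ' (T p.1)) b}) ∪
        (Prod.fst ⁻¹' Gᶜ ∩ {p : X × ℝ | p.2 ≤ b}) := by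
      ext p
      by_cases hp : p.1 ∈ G
      · simp [hp, (ht2 p.1 hp).1]
      · simp [hp, ht3 p.1 hp]
    rw [this]
    refine ((measurable_fst hGm).inter (measurableSet_le hF ?_)).union
      ((measurable_fst hGm.compl).inter (measurableSet_le measurable_snd measurable_const))
    exact (hFb b).comp (hT.comp measurable_fst)
  refine ⟨t, htm, ht1, ?_⟩
  have hfm : Measurable (fun p : X × ℝ => (T p.1, t p.1 p.2)) :=
    (hT.comp measurable_fst).prodMk htm
  ext E hE
  rw [Measure.map_apply hfm hE, Measure.compProd_apply (hfm hE), Measure.compProd_apply hE,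
    ← hmap, lintegral_map (Kernel.measurable_kernel_prodMk_left hE) hT]
  apply lintegral_congr_ae
  filter_upwards [hGae] with x hx
  rw [← (ht2 x hx).2, Measure.map_apply (ht1 x).monotone.measurable (measurable_prodMk_left hE)]
  rfl

lemma kr_map_inj {X Y : Type*} [MeasurableSpace X] [StandardBorelSpace X]
    [MeasurableSpace Y] [StandardBorelSpace Y]
    (ρ₁ ρ₂ : Measure X) (f : X → Y) (hf : Measurable f) (D : Set X) (hD : MeasurableSet D)
    (hinj : InjOn f D) (h1 : ρ₁ Dᶜ = 0) (h2 : ρ₂ Dᶜ = 0) (h : ρ₁.map f = ρ₂.map f) :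
    ρ₁ = ρ₂ := by
  ext E hE
  have key : ∀ ρ : Measure X, ρ Dᶜ = 0 → ρ E = ρ.map f (f '' (E ∩ D)) := by
    intro ρ hρ
    have hm : MeasurableSet (f '' (E ∩ D)) :=
      (hE.inter hD).image_of_measurable_injOn hf (hinj.mono inter_subset_right)
    rw [Measure.map_apply hf hm, ← measure_inter_conull hρ, ← measure_inter_conull (s := f ⁻¹' _) hρ]
    congr 1
    ext x
    constructor
    · rintro ⟨a, b⟩
      exact ⟨⟨x, ⟨a, b⟩, rfl⟩, b⟩
    · rintro ⟨⟨y, ⟨a, b⟩, hy⟩, c⟩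
      rw [← hinj b c hy]
      exact ⟨a, b⟩
  rw [key ρ₁ h1, key ρ₂ h2, h]

lemma kr_ac {X : Type*} [MeasureSpace X] [StandardBorelSpace X] [SigmaFinite (volume : Measure X)]
    (ρ : Measure (X × ℝ)) [IsProbabilityMeasure ρ] (h1 : ρ ≪ (volume : Measure X).prod volume)
    (h2 : (volume : Measure X).prod volume ≪ ρ) :
    ρ.fst ≪ volume ∧ volume ≪ ρ.fst ∧
    ∀ᵐ x ∂ρ.fst, ρ.condKernel x ≪ volume ∧ (volume : Measure ℝ) ≪ ρ.condKernel x := by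
  have ha : ρ.fst ≪ volume := by
    refine Measure.AbsolutelyContinuous.mk fun s hs h => ?_
    rw [Measure.fst_apply hs]
    apply h1
    rw [← prod_univ, Measure.prod_prod, h, zero_mul]
  have hb : volume ≪ ρ.fst := by
    refine Measure.AbsolutelyContinuous.mk fun s hs h => ?_
    rw [Measure.fst_apply hs] at h
    have := h2 h
    rw [← prod_univ, Measure.prod_prod] at this
    simpa using this
  refine ⟨ha, hb, ?_⟩
  have g1 : (gaussianReal 0 1) ≪ volume := gaussianReal_absolutelyContinuous 0 one_ne_zero
  have g2 : volume ≪ (gaussianReal 0 1) := gaussianReal_absolutelyContinuous' 0 one_ne_zero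
  have hρ : ρ.fst ⊗ₘ ρ.condKernel = ρ := ρ.disintegrate ρ.condKernel
  have c1 : ρ.fst ⊗ₘ ρ.condKernel ≪ volume ⊗ₘ (Kernel.const X (gaussianReal 0 1)) := by
    rw [hρ, Measure.compProd_const]
    exact h1.trans (Measure.AbsolutelyContinuous.rfl.prod g2)
  have c2 : volume ⊗ₘ (Kernel.const X (gaussianReal 0 1)) ≪ ρ.fst ⊗ₘ ρ.condKernel := by
    rw [hρ, Measure.compProd_const]
    exact (Measure.AbsolutelyContinuous.rfl.prod g1).trans h2
  filter_upwards [c1.kernel_of_compProd, ha.ae_le c2.kernel_of_compProd] with x hx hx'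
  rw [Kernel.const_apply] at hx hx'
  exact ⟨hx.trans g1, g2.trans hx'⟩

lemma kr_aemeasurable_fst {X Y : Type*} [MeasurableSpace X] [MeasurableSpace Y]
    (α : Measure X) [SFinite α] (β : Measure ℝ) [SFinite β] [NeZero β] (g : X → Y)
    (h : AEMeasurable (fun p : X × ℝ => g p.1) (α.prod β)) : AEMeasurable g α := by
  have h' := h.prod_swap
  have := Measure.ae_ae_of_ae_prod h'.ae_eq_mk
  obtain ⟨s, hs⟩ := this.exists
  exact ⟨fun x => h'.mk _ (s, x), h'.measurable_mk.comp measurable_prodMk_left, hs⟩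

/-- Uniqueness with identity on the base. -/
lemma kr_unique_base {X : Type*} [MeasurableSpace X]
    (μ : Measure (X × ℝ)) [IsProbabilityMeasure μ] (t₁ t₂ : X → ℝ → ℝ)
    (hm1 : ∀ x, Monotone (t₁ x)) (hm2 : ∀ x, Monotone (t₂ x))
    (ha1 : AEMeasurable (fun p : X × ℝ => t₁ p.1 p.2) μ)
    (ha2 : AEMeasurable (fun p : X × ℝ => t₂ p.1 p.2) μ)
    (h : μ.map (fun p => (p.1, t₁ p.1 p.2)) = μ.map (fun p => (p.1, t₂ p.1 p.2))) :
    (fun p : X × ℝ => t₁ p.1 p.2) =ᵐ[μ] (fun p : X × ℝ => t₂ p.1 p.2) := by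
  have hμ : μ.fst ⊗ₘ μ.condKernel = μ := μ.disintegrate μ.condKernel
  set κ := μ.condKernel
  obtain ⟨u₁, hu1, e1⟩ := id ha1
  obtain ⟨u₂, hu2, e2⟩ := id ha2
  have s1 : ∀ᵐ x ∂μ.fst, ∀ᵐ s ∂κ x, t₁ x s = u₁ (x, s) := by
    rw [← hμ] at e1; exact Measure.ae_ae_of_ae_compProd e1
  have s2 : ∀ᵐ x ∂μ.fst, ∀ᵐ s ∂κ x, t₂ x s = u₂ (x, s) := by
    rw [← hμ] at e2; exact Measure.ae_ae_of_ae_compProd e2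
  have h' : μ.map (fun p => (p.1, u₁ p)) = μ.map (fun p => (p.1, u₂ p)) := by
    rw [← Measure.map_congr (f := fun p => (p.1, t₁ p.1 p.2)), h]
    · apply Measure.map_congr
      filter_upwards [e2] with p hp using by simp [hp]
    · filter_upwards [e1] with p hp using by simp [hp]
  have m1 : Measurable (fun p : X × ℝ => (p.1, u₁ p)) := measurable_fst.prodMk hu1
  have m2 : Measurable (fun p : X × ℝ => (p.1, u₂ p)) := measurable_fst.prodMk hu2
  have hset : ∀ b : ℝ, ∀ u : X × ℝ → ℝ, Measurable u →
      Measurable fun x => κ x (Prod.mk x ⁻¹' (u ⁻¹' Iic b)) :=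
    fun b u hu => Kernel.measurable_kernel_prodMk_left (hu measurableSet_Iic)
  have hint : ∀ b : ℝ, ∀ u : X × ℝ → ℝ, Measurable u → ∀ A, MeasurableSet A →
      ∫⁻ x in A, κ x (Prod.mk x ⁻¹' (u ⁻¹' Iic b)) ∂μ.fst =
        μ.map (fun p => (p.1, u p)) (A ×ˢ Iic b) := by
    intro b u hu A hA
    rw [Measure.map_apply (measurable_fst.prodMk hu) (hA.prod measurableSet_Iic)]
    nth_rewrite 2 [← hμ]
    rw [Measure.compProd_apply ((measurable_fst.prodMk hu) (hA.prod measurableSet_Iic)),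
      ← lintegral_indicator hA]
    congr 1 with x
    by_cases hx : x ∈ A
    · simp only [hx, indicator_of_mem]
      congr 1
      ext s
      simp [hx]
    · simp only [hx, not_false_eq_true, indicator_of_notMem]
      symm
      convert measure_empty (μ := κ x)
      ext s
      simp [hx]
  have heq : ∀ b : ℝ, ∀ᵐ x ∂μ.fst, κ x (Prod.mk x ⁻¹' (u₁ ⁻¹' Iic b)) =
      κ x (Prod.mk x ⁻¹' (u₂ ⁻¹' Iic b)) := by
    intro b
    refine ae_eq_of_forall_setLIntegral_eq_of_sigmaFinite (hset b _ hu1) (hset b _ hu2) ?_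
    intro A hA _
    rw [hint b _ hu1 A hA, hint b _ hu2 A hA, h']
  have heq' : ∀ᵐ x ∂μ.fst, ∀ q : ℚ, κ x (Prod.mk x ⁻¹' (u₁ ⁻¹' Iic (q : ℝ))) =
      κ x (Prod.mk x ⁻¹' (u₂ ⁻¹' Iic (q : ℝ))) := ae_all_iff.2 fun q => heq q
  have fin : ∀ᵐ x ∂μ.fst, ∀ᵐ s ∂κ x, u₁ (x, s) = u₂ (x, s) := by
    filter_upwards [s1, s2, heq'] with x h1 h2 h3
    have hq : ∀ q : ℚ, ∀ᵐ s ∂κ x, (t₁ x s ≤ q ↔ t₂ x s ≤ q) := by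
      intro q
      have i1 : κ x {s | t₁ x s ≤ q} = κ x (Prod.mk x ⁻¹' (u₁ ⁻¹' Iic (q : ℝ))) := by
        apply measure_congr
        filter_upwards [h1] with s hs
        apply propext
        change t₁ x s ≤ q ↔ u₁ (x, s) ≤ q
        rw [hs]
      have i2 : κ x {s | t₂ x s ≤ q} = κ x (Prod.mk x ⁻¹' (u₂ ⁻¹' Iic (q : ℝ))) := by
        apply measure_congr
        filter_upwards [h2] with s hs
        apply propext
        change t₂ x s ≤ q ↔ u₂ (x, s) ≤ q
        rw [hs]
      have i3 : κ x {s | t₁ x s ≤ q} = κ x {s | t₂ x s ≤ q} := by rw [i1, i2, h3 q]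
      have n1 : MeasurableSet {s | t₁ x s ≤ q} := (hm1 x).measurable measurableSet_Iic
      have n2 : MeasurableSet {s | t₂ x s ≤ q} := (hm2 x).measurable measurableSet_Iic
      have l1 : IsLowerSet {s | t₁ x s ≤ q} := fun a b hba ha => (hm1 x hba).trans ha
      have l2 : IsLowerSet {s | t₂ x s ≤ q} := fun a b hba ha => (hm2 x hba).trans ha
      have : {s | t₁ x s ≤ q} =ᵐ[κ x] {s | t₂ x s ≤ q} := by
        rcases l1.total l2 with hsub | hsub
        · exact ae_eq_of_subset_of_measure_ge hsub i3.ge n1.nullMeasurableSet (measure_ne_top _ _)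
        · exact (ae_eq_of_subset_of_measure_ge hsub i3.le n2.nullMeasurableSet
            (measure_ne_top _ _)).symm
      filter_upwards [this] with s hs
      exact iff_of_eq hs
    filter_upwards [ae_all_iff.2 hq, h1, h2] with s hs h1 h2
    rw [← h1, ← h2]
    apply le_antisymm
    · by_contra hlt
      push Not at hlt
      obtain ⟨q, hq1, hq2⟩ := exists_rat_btwn hlt
      exact absurd ((hs q).2 hq1.le) (not_le.2 hq2)
    · by_contra hlt
      push Not at hlt
      obtain ⟨q, hq1, hq2⟩ := exists_rat_btwn hlt
      exact absurd ((hs q).1 hq1.le) (not_le.2 hq2)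
  have fin' : ∀ᵐ p ∂μ, u₁ p = u₂ p := by
    rw [← hμ]
    exact (Measure.ae_compProd_iff (measurableSet_eq_fun hu1 hu2)).2 fin
  filter_upwards [e1, e2, fin'] with p h1 h2 h3
  rw [h1, h2]; exact h3

lemma kr_unique_prod {X : Type*} [MeasurableSpace X] [StandardBorelSpace X]
    (μ : Measure (X × ℝ)) [IsProbabilityMeasure μ] (t₁ t₂ : X → ℝ → ℝ)
    (hm1 : ∀ x, Monotone (t₁ x)) (hm2 : ∀ x, Monotone (t₂ x))
    (ha1 : AEMeasurable (fun p : X × ℝ => t₁ p.1 p.2) μ)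
    (ha2 : AEMeasurable (fun p : X × ℝ => t₂ p.1 p.2) μ)
    (T : X → X) (hinj : Function.Injective T) (hT : AEMeasurable T μ.fst)
    (h : μ.map (fun p => (T p.1, t₁ p.1 p.2)) = μ.map (fun p => (T p.1, t₂ p.1 p.2))) :
    (fun p : X × ℝ => t₁ p.1 p.2) =ᵐ[μ] (fun p : X × ℝ => t₂ p.1 p.2) := by
  refine kr_unique_base μ t₁ t₂ hm1 hm2 ha1 ha2 ?_
  obtain ⟨D, hDae, hDm, hD⟩ := hT.ae_eq_mk.exists_measurable_mem
  set g := hT.mk T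
  have hg : Measurable g := hT.measurable_mk
  have hDμ : ∀ᵐ p ∂μ, p.1 ∈ D := ae_of_ae_map measurable_fst.aemeasurable hDae
  have main : ∀ t : X → ℝ → ℝ, AEMeasurable (fun p : X × ℝ => t p.1 p.2) μ →
      (μ.map (fun p => (p.1, t p.1 p.2))).map (Prod.map g id) =
        μ.map (fun p => (T p.1, t p.1 p.2)) ∧
      μ.map (fun p => (p.1, t p.1 p.2)) (Prod.fst ⁻¹' D)ᶜ = 0 := by
    intro t ht
    have hm : AEMeasurable (fun p : X × ℝ => (p.1, t p.1 p.2)) μ :=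
      measurable_fst.aemeasurable.prodMk ht
    constructor
    · rw [AEMeasurable.map_map_of_aemeasurable (by fun_prop) hm]
      apply Measure.map_congr
      filter_upwards [hDμ] with p hp
      simp [hD _ hp, g]
    · rw [Measure.map_apply_of_aemeasurable hm (measurable_fst hDm).compl]
      exact hDμ
  refine kr_map_inj _ _ (Prod.map g id) (by fun_prop) (Prod.fst ⁻¹' D) (measurable_fst hDm) ?_
    (main t₁ ha1).2 (main t₂ ha2).2 ?_
  · rintro ⟨a, b⟩ ha ⟨c, d⟩ hc hh
    simp only [Prod.map_apply, id, Prod.mk.injEq] at hh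
    have : T a = T c := by rw [hD a ha, hD c hc]; exact hh.1
    rw [hinj this, hh.2]
  · rw [(main t₁ ha1).1, (main t₂ ha2).1, h]

lemma kr_injective {n : ℕ} (T : (Fin n → ℝ) → (Fin n → ℝ)) (h1 : LowerTriangular T)
    (h2 : MonotoneIncreasingMap T) : Function.Injective T := by
  intro x y hxy
  have key : ∀ m : ℕ, ∀ k : Fin n, k.val = m → x k = y k := by
    intro m
    induction m using Nat.strong_induction_on with
    | _ m ih =>
      intro k hk
      apply (h2 k x).injective
      simp only [Function.update_eq_self]
      rw [hxy]
      apply h1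
      intro j hj
      rcases hj.lt_or_eq with hlt | rfl
      · rw [Function.update_of_ne hlt.ne, ih j.val (by omega) j rfl]
      · simp
  exact funext fun k => key _ k rfl

/-- Splitting off the last coordinate. -/
def krE (n : ℕ) : (Fin (n + 1) → ℝ) ≃ᵐ (Fin n → ℝ) × ℝ :=
  (MeasurableEquiv.piFinSuccAbove (fun _ => ℝ) (Fin.last n)).trans MeasurableEquiv.prodComm

lemma krE_apply_fst (n : ℕ) (x : Fin (n + 1) → ℝ) (i : Fin n) :
    (krE n x).1 i = x i.castSucc := by
  rw [← Fin.succAbove_last]; rfl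

lemma krE_apply_snd (n : ℕ) (x : Fin (n + 1) → ℝ) : (krE n x).2 = x (Fin.last n) := rfl

lemma krE_symm_castSucc (n : ℕ) (p : (Fin n → ℝ) × ℝ) (i : Fin n) :
    (krE n).symm p i.castSucc = p.1 i := by
  rw [← krE_apply_fst n ((krE n).symm p), MeasurableEquiv.apply_symm_apply]

lemma krE_symm_last (n : ℕ) (p : (Fin n → ℝ) × ℝ) :
    (krE n).symm p (Fin.last n) = p.2 := by
  rw [← krE_apply_snd n ((krE n).symm p), MeasurableEquiv.apply_symm_apply]

lemma krE_mp (n : ℕ) : MeasurePreserving (krE n) volume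
    ((volume : Measure (Fin n → ℝ)).prod volume) :=
  (Measure.measurePreserving_swap (μ := (volume : Measure ℝ))
    (ν := (volume : Measure (Fin n → ℝ)))).comp
    (volume_preserving_piFinSuccAbove (fun _ => ℝ) (Fin.last n))

lemma krE_ac (n : ℕ) (μ : Measure (Fin (n + 1) → ℝ)) (h1 : μ ≪ volume) (h2 : volume ≪ μ) :
    μ.map (krE n) ≪ (volume : Measure (Fin n → ℝ)).prod volume ∧
    (volume : Measure (Fin n → ℝ)).prod volume ≪ μ.map (krE n) := by
  rw [← (krE_mp n).map_eq]
  exact ⟨h1.map (krE n).measurable, h2.map (krE n).measurable⟩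

lemma kr_exists (n : ℕ) : ∀ (μ ν : Measure (Fin n → ℝ)) [IsProbabilityMeasure μ]
    [IsProbabilityMeasure ν], μ ≪ volume → volume ≪ μ → ν ≪ volume → volume ≪ ν →
    ∃ T : (Fin n → ℝ) → (Fin n → ℝ), Measurable T ∧
      LowerTriangular T ∧ MonotoneIncreasingMap T ∧ Measure.map T μ = ν := by
  induction n with
  | zero =>
    intro μ ν _ _ _ _ _ _
    refine ⟨id, measurable_id, fun k => k.elim0, fun k => k.elim0, ?_⟩
    rw [Measure.map_id]
    ext s _
    rcases Subsingleton.eq_empty_or_singleton (s := s) (Set.subsingleton_of_subsingleton)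
      with rfl | ⟨x, rfl⟩
    · simp
    · have : ({x} : Set (Fin 0 → ℝ)) = univ := by
        ext y; simp [Subsingleton.elim y x]
      simp [this]
  | succ n ih =>
    intro μ ν _ _ h1 h2 h3 h4
    have : IsProbabilityMeasure (μ.map (krE n)) :=
      Measure.isProbabilityMeasure_map (krE n).measurable.aemeasurable
    have : IsProbabilityMeasure (ν.map (krE n)) :=
      Measure.isProbabilityMeasure_map (krE n).measurable.aemeasurable
    obtain ⟨a1, a2⟩ := krE_ac n μ h1 h2
    obtain ⟨b1, b2⟩ := krE_ac n ν h3 h4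
    obtain ⟨c1, c2, c3⟩ := kr_ac _ a1 a2
    obtain ⟨d1, d2, d3⟩ := kr_ac _ b1 b2
    obtain ⟨T', hT'm, hT't, hT'i, hT'⟩ := ih _ _ c1 c2 d1 d2
    obtain ⟨t, htm, htmono, ht⟩ := kr_exists_prod _ _ _ _ T' hT'm hT' c3 d3
    rw [(μ.map (krE n)).disintegrate, (ν.map (krE n)).disintegrate] at ht
    have hfm : Measurable (fun p : (Fin n → ℝ) × ℝ => (T' p.1, t p.1 p.2)) :=
      (hT'm.comp measurable_fst).prodMk htm
    refine ⟨fun x => (krE n).symm (T' (krE n x).1, t (krE n x).1 (krE n x).2), ?_, ?_, ?_, ?_⟩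
    · exact (krE n).symm.measurable.comp (hfm.comp (krE n).measurable)
    · intro k x y hxy
      induction k using Fin.lastCases with
      | last =>
        have : x = y := funext fun j => hxy j (Fin.le_last j)
        rw [this]
      | cast i =>
        simp only [krE_symm_castSucc]
        apply hT't
        intro j hj
        rw [krE_apply_fst, krE_apply_fst]
        exact hxy _ (by simpa using hj)
    · intro k x
      induction k using Fin.lastCases with
      | last =>
        have : ∀ s, (krE n (Function.update x (Fin.last n) s)).1 = (krE n x).1 := by
          intro s
          funext i
          rw [krE_apply_fst, krE_apply_fst, Function.update_of_ne (Fin.castSucc_lt_last i).ne]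
        simp only [krE_symm_last, this, krE_apply_snd, Function.update_self]
        exact htmono _
      | cast i =>
        have : ∀ s, (krE n (Function.update x i.castSucc s)).1 =
            Function.update (krE n x).1 i s := by
          intro s
          funext j
          rw [krE_apply_fst]
          by_cases hj : j = i
          · subst hj; simp
          · rw [Function.update_of_ne hj, Function.update_of_ne (by simpa using hj),
              krE_apply_fst]
        simp only [krE_symm_castSucc, this]
        exact hT'i i _
    · have e1 : (fun x => (krE n).symm (T' (krE n x).1, t (krE n x).1 (krE n x).2)) =
          (krE n).symm ∘ (fun p : (Fin n → ℝ) × ℝ => (T' p.1, t p.1 p.2)) ∘ (krE n) := rfl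
      rw [e1, ← Measure.map_map (krE n).symm.measurable (hfm.comp (krE n).measurable),
        ← Measure.map_map hfm (krE n).measurable, ht,
        Measure.map_map (krE n).symm.measurable (krE n).measurable]
      simp

lemma kr_split {n : ℕ} (T : (Fin (n + 1) → ℝ) → (Fin (n + 1) → ℝ)) (h1 : LowerTriangular T)
    (h2 : MonotoneIncreasingMap T) :
    ∃ (T' : (Fin n → ℝ) → (Fin n → ℝ)) (t : (Fin n → ℝ) → ℝ → ℝ),
      LowerTriangular T' ∧ MonotoneIncreasingMap T' ∧ (∀ x, Monotone (t x)) ∧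
      ∀ p, krE n (T ((krE n).symm p)) = (T' p.1, t p.1 p.2) := by
  have hcast : ∀ (i : Fin n) (p : (Fin n → ℝ) × ℝ) (q : Fin (n + 1) → ℝ),
      (∀ j ≤ i, p.1 j = q j.castSucc) → (T ((krE n).symm p)) i.castSucc = T q i.castSucc := by
    intro i p q h
    apply h1
    intro j hj
    induction j using Fin.lastCases with
    | last => exact absurd hj (not_le.2 (Fin.castSucc_lt_last i))
    | cast j =>
      rw [krE_symm_castSucc]
      exact h j (by simpa using hj)
  refine ⟨fun y => (krE n (T ((krE n).symm (y, 0)))).1,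
    fun y s => (krE n (T ((krE n).symm (y, s)))).2, ?_, ?_, ?_, ?_⟩
  · intro k x y hxy
    simp only [krE_apply_fst]
    apply hcast
    intro j hj
    rw [krE_symm_castSucc]
    exact hxy j hj
  · intro k x
    have : (fun s => (krE n (T ((krE n).symm (Function.update x k s, 0)))).1 k) =
        fun s => T (Function.update ((krE n).symm (x, 0)) k.castSucc s) k.castSucc := by
      funext s
      rw [krE_apply_fst]
      apply hcast
      intro j hj
      by_cases hjk : j = k
      · subst hjk; simp
      · rw [Function.update_of_ne (by simpa using hjk), krE_symm_castSucc]
        simp [Function.update_of_ne hjk]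
    rw [this]
    exact h2 _ _
  · intro x
    have : (fun s => (krE n (T ((krE n).symm (x, s)))).2) =
        fun s => T (Function.update ((krE n).symm (x, 0)) (Fin.last n) s) (Fin.last n) := by
      funext s
      rw [krE_apply_snd]
      congr 1
      funext j
      induction j using Fin.lastCases with
      | last => rw [krE_symm_last]; simp
      | cast j =>
        rw [Function.update_of_ne (Fin.castSucc_lt_last j).ne, krE_symm_castSucc,
          krE_symm_castSucc]
    change Monotone (fun s => (krE n (T ((krE n).symm (x, s)))).2)
    rw [this]
    exact (h2 _ _).monotone
  · intro p
    refine Prod.ext ?_ rfl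
    funext i
    simp only [krE_apply_fst]
    apply hcast
    intro j hj
    rw [krE_symm_castSucc]

lemma kr_unique (n : ℕ) : ∀ (μ : Measure (Fin n → ℝ)) [IsProbabilityMeasure μ],
    μ ≪ volume → volume ≪ μ → ∀ T₁ T₂ : (Fin n → ℝ) → (Fin n → ℝ),
    LowerTriangular T₁ → MonotoneIncreasingMap T₁ → AEMeasurable T₁ μ →
    LowerTriangular T₂ → MonotoneIncreasingMap T₂ → AEMeasurable T₂ μ →
    Measure.map T₁ μ = Measure.map T₂ μ → T₁ =ᵐ[μ] T₂ := by
  induction n with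
  | zero =>
    intro μ _ _ _ T₁ T₂ _ _ _ _ _ _ _
    exact Filter.Eventually.of_forall fun x => Subsingleton.elim _ _
  | succ n ih =>
    intro μ _ h1 h2 T₁ T₂ ht1 hm1 ha1 ht2 hm2 ha2 hmap
    have : IsProbabilityMeasure (μ.map (krE n)) :=
      Measure.isProbabilityMeasure_map (krE n).measurable.aemeasurable
    obtain ⟨a1, a2⟩ := krE_ac n μ h1 h2
    obtain ⟨c1, c2, -⟩ := kr_ac _ a1 a2
    set m := μ.map (krE n) with hm
    have back : m.map (krE n).symm = μ := by
      rw [hm, Measure.map_map (krE n).symm.measurable (krE n).measurable]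
      simp
    obtain ⟨S₁, t₁, hS1t, hS1m, hmono1, hs1⟩ := kr_split T₁ ht1 hm1
    obtain ⟨S₂, t₂, hS2t, hS2m, hmono2, hs2⟩ := kr_split T₂ ht2 hm2
    have hf : ∀ T : (Fin (n + 1) → ℝ) → (Fin (n + 1) → ℝ), AEMeasurable T μ →
        AEMeasurable (fun p => krE n (T ((krE n).symm p))) m ∧
        m.map (fun p => krE n (T ((krE n).symm p))) = (μ.map T).map (krE n) := by
      intro T hT
      have hT' : AEMeasurable (fun x => krE n (T x)) μ := (krE n).measurable.comp_aemeasurable hT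
      have hT'' := hT'
      rw [← back] at hT''
      constructor
      · exact hT''.comp_measurable (krE n).symm.measurable
      · have := AEMeasurable.map_map_of_aemeasurable hT'' (krE n).symm.measurable.aemeasurable
        rw [back] at this
        rw [AEMeasurable.map_map_of_aemeasurable (krE n).measurable.aemeasurable hT]
        exact this.symm
    obtain ⟨f1, g1⟩ := hf T₁ ha1
    obtain ⟨f2, g2⟩ := hf T₂ ha2
    simp only [hs1] at f1 g1
    simp only [hs2] at f2 g2
    have hSm : ∀ (S : (Fin n → ℝ) → (Fin n → ℝ)) (t : (Fin n → ℝ) → ℝ → ℝ),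
        AEMeasurable (fun p : (Fin n → ℝ) × ℝ => (S p.1, t p.1 p.2)) m →
        AEMeasurable S m.fst ∧ m.fst.map S = (m.map (fun p => (S p.1, t p.1 p.2))).fst := by
      intro S t h
      have hS : AEMeasurable S m.fst := by
        have := (measurable_fst.comp_aemeasurable h).mono_ac a2
        exact (kr_aemeasurable_fst _ _ S this).mono_ac c1
      refine ⟨hS, ?_⟩
      rw [Measure.fst, Measure.fst, AEMeasurable.map_map_of_aemeasurable hS measurable_fst.aemeasurable,
        AEMeasurable.map_map_of_aemeasurable measurable_fst.aemeasurable h]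
      rfl
    obtain ⟨k1, l1⟩ := hSm S₁ t₁ f1
    obtain ⟨k2, l2⟩ := hSm S₂ t₂ f2
    have hS : S₁ =ᵐ[m.fst] S₂ := by
      apply ih m.fst c1 c2 S₁ S₂ hS1t hS1m k1 hS2t hS2m k2
      rw [l1, l2, g1, g2, hmap]
    have hS' : ∀ᵐ p ∂m, S₁ p.1 = S₂ p.1 := ae_of_ae_map measurable_fst.aemeasurable hS
    have ht : (fun p : (Fin n → ℝ) × ℝ => t₁ p.1 p.2) =ᵐ[m] fun p => t₂ p.1 p.2 := by
      refine kr_unique_prod m t₁ t₂ hmono1 hmono2 (measurable_snd.comp_aemeasurable f1)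
        (measurable_snd.comp_aemeasurable f2) S₁ (kr_injective S₁ hS1t hS1m) k1 ?_
      rw [g1, hmap, ← g2]
      apply Measure.map_congr
      filter_upwards [hS'] with p hp
      rw [hp]
    have fin : ∀ᵐ p ∂m, T₁ ((krE n).symm p) = T₂ ((krE n).symm p) := by
      filter_upwards [hS', ht] with p hp hq
      apply (krE n).injective
      rw [hs1, hs2, hp]
      exact congrArg _ hq
    have := ae_of_ae_map (krE n).measurable.aemeasurable fin
    filter_upwards [this] with x hx
    simpa using hx

end KR

/-- **Existence and a.e. uniqueness of the Knothe–Rosenblatt rearrangement.**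
For any two fully supported absolutely continuous Borel probability measures `μ, ν` on `ℝⁿ`
there exists a lower triangular, monotone increasing map pushing `μ` forward to `ν`; moreover
any two such maps agree `μ`-almost everywhere. -/
theorem exists_knothe_rosenblatt_and_ae_unique
    (n : ℕ) (hn : 0 < n)
    (μ ν : Measure (Fin n → ℝ)) [IsProbabilityMeasure μ] [IsProbabilityMeasure ν]
    (pμ pν : (Fin n → ℝ) → ℝ) (hpμmeas : Measurable pμ) (hpνmeas : Measurable pν)
    (hμd : μ = (volume : Measure (Fin n → ℝ)).withDensity (fun x => ENNReal.ofReal (pμ x)))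
    (hνd : ν = (volume : Measure (Fin n → ℝ)).withDensity (fun x => ENNReal.ofReal (pν x)))
    (hpμpos : ∀ᵐ x ∂(volume : Measure (Fin n → ℝ)), 0 < pμ x)
    (hpνpos : ∀ᵐ x ∂(volume : Measure (Fin n → ℝ)), 0 < pν x) :
    (∃ T : (Fin n → ℝ) → (Fin n → ℝ),
      LowerTriangular T ∧ MonotoneIncreasingMap T ∧ Measure.map T μ = ν) ∧
    (∀ T₁ T₂ : (Fin n → ℝ) → (Fin n → ℝ),
      LowerTriangular T₁ → MonotoneIncreasingMap T₁ → Measure.map T₁ μ = ν →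
      LowerTriangular T₂ → MonotoneIncreasingMap T₂ → Measure.map T₂ μ = ν →
      T₁ =ᵐ[μ] T₂) := by
  have hμ1 : μ ≪ volume := by rw [hμd]; exact withDensity_absolutelyContinuous _ _
  have hν1 : ν ≪ volume := by rw [hνd]; exact withDensity_absolutelyContinuous _ _
  have hμ2 : volume ≪ μ := by
    rw [hμd]
    refine withDensity_absolutelyContinuous' hpμmeas.ennreal_ofReal.aemeasurable ?_
    filter_upwards [hpμpos] with x hx
    simpa using hx
  have hν2 : volume ≪ ν := by
    rw [hνd]
    refine withDensity_absolutelyContinuous' hpνmeas.ennreal_ofReal.aemeasurable ?_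
    filter_upwards [hpνpos] with x hx
    simpa using hx
  constructor
  · obtain ⟨T, -, h⟩ := kr_exists n μ ν hμ1 hμ2 hν1 hν2
    exact ⟨T, h⟩
  · intro T₁ T₂ a1 b1 c1 a2 b2 c2
    have hae : ∀ T : (Fin n → ℝ) → (Fin n → ℝ), μ.map T = ν → AEMeasurable T μ := by
      intro T hT
      by_contra hc
      rw [Measure.map_of_not_aemeasurable hc] at hT
      exact IsProbabilityMeasure.ne_zero ν hT.symm
    exact kr_unique n μ hμ1 hμ2 T₁ T₂ a1 b1 (hae _ c1) a2 b2 (hae _ c2) (c1.trans c2.symm)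
end
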